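/- arXiv:2603.24951 — 3 statements merged into one kernel-verified Lean document; each statement's English description precedes it below -/
import Mathlib

section
/- Let φ : ℝⁿ → ℝ ∪ {+∞} be proper and lower semicontinuous. Then φ is convex if and only if there exists ρ ≥ 0 such that φ is ρ-weakly convex and, for every (x,y) ∈ gph ∂φ and every (w,z) ∈ T_{gph ∂φ}(x,y), one has ⟨z,w⟩ ≥ 0. -/
open scoped RealInnerProductSpace
open Filter Topology MeasureTheory Set

noncomputable section

variable {n : ℕ}

/-- Convexity of an extended-real-valued function `φ : ℝⁿ → ℝ ∪ {+∞}`. -/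
def ERealConvex {F : Type*} [AddCommGroup F] [Module ℝ F] (φ : F → EReal) : Prop :=
  ∀ x y : F, ∀ a b : ℝ, 0 ≤ a → 0 ≤ b → a + b = 1 →
    φ (a • x + b • y) ≤ (a : EReal) * φ x + (b : EReal) * φ y

/-- The shifted function `x ↦ φ(x) + (ρ/2)‖x‖²`. -/
def shiftFun (ρ : ℝ) (φ : EuclideanSpace ℝ (Fin n) → EReal) :
    EuclideanSpace ℝ (Fin n) → EReal :=
  fun x => φ x + (((ρ / 2) * ‖x‖ ^ 2 : ℝ) : EReal)

/-- The subdifferential of a `ρ`-weakly convex function. -/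
def subdiff (ρ : ℝ) (φ : EuclideanSpace ℝ (Fin n) → EReal)
    (x : EuclideanSpace ℝ (Fin n)) : Set (EuclideanSpace ℝ (Fin n)) :=
  {v | φ x ≠ ⊤ ∧
    ∀ u, φ x + ((⟪v, u - x⟫ - (ρ / 2) * ‖u - x‖ ^ 2 : ℝ) : EReal) ≤ φ u}

/-- Graph of the subdifferential mapping. -/
def gphSubdiff (ρ : ℝ) (φ : EuclideanSpace ℝ (Fin n) → EReal) :
    Set (EuclideanSpace ℝ (Fin n) × EuclideanSpace ℝ (Fin n)) :=
  {p | p.2 ∈ subdiff ρ φ p.1}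

/-- The (Bouligand–Severi) tangent/contingent cone to `S` at `z`. -/
def contTangentCone {F : Type*} [NormedAddCommGroup F] [NormedSpace ℝ F]
    (S : Set F) (z : F) : Set F :=
  {w | ∃ (t : ℕ → ℝ) (ws : ℕ → F), (∀ k, 0 < t k) ∧ Tendsto t atTop (𝓝 0) ∧
    Tendsto ws atTop (𝓝 w) ∧ ∀ k, z + t k • ws k ∈ S}

/-- Inner product of pairs in `ℝⁿ × ℝⁿ`. -/
def pairInner (p q : EuclideanSpace ℝ (Fin n) × EuclideanSpace ℝ (Fin n)) : ℝ :=
  ⟪p.1, q.1⟫ + ⟪p.2, q.2⟫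

/-- The (Fréchet) regular normal cone to `S` at `z`. -/
def regNormalCone (S : Set (EuclideanSpace ℝ (Fin n) × EuclideanSpace ℝ (Fin n)))
    (z : EuclideanSpace ℝ (Fin n) × EuclideanSpace ℝ (Fin n)) :
    Set (EuclideanSpace ℝ (Fin n) × EuclideanSpace ℝ (Fin n)) :=
  {v | ∀ ε > (0 : ℝ), ∃ δ > (0 : ℝ), ∀ u ∈ S, ‖u - z‖ < δ →
      pairInner v (u - z) ≤ ε * ‖u - z‖}

/-- The (Mordukhovich) limiting normal cone to `S` at `z`. -/
def limNormalCone (S : Set (EuclideanSpace ℝ (Fin n) × EuclideanSpace ℝ (Fin n)))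
    (z : EuclideanSpace ℝ (Fin n) × EuclideanSpace ℝ (Fin n)) :
    Set (EuclideanSpace ℝ (Fin n) × EuclideanSpace ℝ (Fin n)) :=
  {v | ∃ zs vs : ℕ → EuclideanSpace ℝ (Fin n) × EuclideanSpace ℝ (Fin n),
    (∀ k, zs k ∈ S) ∧ Tendsto zs atTop (𝓝 z) ∧ Tendsto vs atTop (𝓝 v) ∧
    ∀ k, vs k ∈ regNormalCone S (zs k)}

/-- The Moreau envelope `e_λ φ`. -/
def moreau (lam : ℝ) (φ : EuclideanSpace ℝ (Fin n) → EReal)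
    (x : EuclideanSpace ℝ (Fin n)) : EReal :=
  ⨅ y, (φ y + ((‖y - x‖ ^ 2 / (2 * lam) : ℝ) : EReal))

/-- Second-order difference quotient `Δ²_τ φ(x,v)(u)`. -/
def delta2 (φ : EuclideanSpace ℝ (Fin n) → EReal) (x v : EuclideanSpace ℝ (Fin n))
    (τ : ℝ) (u : EuclideanSpace ℝ (Fin n)) : EReal :=
  ((2 / τ ^ 2 : ℝ) : EReal) * (φ (x + τ • u) - φ x - ((τ * ⟪v, u⟫ : ℝ) : EReal))

/-- The second subderivative `d²φ(x,v)(w)`. -/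
def secondSubderiv (φ : EuclideanSpace ℝ (Fin n) → EReal)
    (x v w : EuclideanSpace ℝ (Fin n)) : EReal :=
  Filter.liminf (fun p : ℝ × EuclideanSpace ℝ (Fin n) => delta2 φ x v p.1 p.2)
    ((𝓝[>] (0 : ℝ)) ×ˢ 𝓝 w)

/-- Twice epi-differentiability of `φ` at `x` for `v`. -/
def TwiceEpiDiff (φ : EuclideanSpace ℝ (Fin n) → EReal)
    (x v : EuclideanSpace ℝ (Fin n)) : Prop :=
  ∀ w : EuclideanSpace ℝ (Fin n), ∀ τ : ℕ → ℝ, (∀ k, 0 < τ k) →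
    Tendsto τ atTop (𝓝 0) →
    ∃ ws : ℕ → EuclideanSpace ℝ (Fin n), Tendsto ws atTop (𝓝 w) ∧
      Tendsto (fun k => delta2 φ x v (τ k) (ws k)) atTop (𝓝 (secondSubderiv φ x v w))

/-- Generalized twice differentiability of `φ` at `x` for `v`. -/
def GenTwiceDiff (φ : EuclideanSpace ℝ (Fin n) → EReal)
    (x v : EuclideanSpace ℝ (Fin n)) : Prop :=
  TwiceEpiDiff φ x v ∧
    ∃ (A : EuclideanSpace ℝ (Fin n) →ₗ[ℝ] EuclideanSpace ℝ (Fin n))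
      (L : Submodule ℝ (EuclideanSpace ℝ (Fin n))),
      (∀ u w, ⟪A u, w⟫ = ⟪u, A w⟫) ∧
      (∀ w ∈ L, secondSubderiv φ x v w = ((⟪w, A w⟫ : ℝ) : EReal)) ∧
      (∀ w ∉ L, secondSubderiv φ x v w = (⊤ : EReal))

lemma fin_coe {φ : EuclideanSpace ℝ (Fin n) → EReal} (hb : ∀ x, φ x ≠ ⊥)
    {x : EuclideanSpace ℝ (Fin n)} (hx : φ x ≠ ⊤) : φ x = ((φ x).toReal : EReal) :=
  (EReal.coe_toReal hx (hb x)).symm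

lemma wc_real {φ : EuclideanSpace ℝ (Fin n) → EReal} {ρ : ℝ} (hb : ∀ x, φ x ≠ ⊥)
    (hc : ERealConvex (shiftFun ρ φ)) {x y : EuclideanSpace ℝ (Fin n)} {p q a b : ℝ}
    (hx : φ x = (p : EReal)) (hy : φ y = (q : EReal)) (ha : 0 ≤ a) (hb' : 0 ≤ b)
    (hab : a + b = 1) :
    φ (a • x + b • y) ≤ ((a * p + b * q + ρ / 2 * (a * b) * ‖x - y‖ ^ 2 : ℝ) : EReal) := by
  have h := hc x y a b ha hb' hab
  unfold shiftFun at h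
  rw [hx, hy] at h
  have hn : ‖a • x + b • y‖ ^ 2 = a * ‖x‖ ^ 2 + b * ‖y‖ ^ 2 - a * b * ‖x - y‖ ^ 2 := by
    have : b = 1 - a := by linarith
    subst this
    rw [norm_add_sq_real, norm_sub_sq_real, norm_smul, norm_smul, real_inner_smul_left,
      real_inner_smul_right, mul_pow, mul_pow, Real.norm_eq_abs, Real.norm_eq_abs, sq_abs, sq_abs]
    ring
  rw [hn] at h
  norm_cast at h
  by_cases ht : φ (a • x + b • y) = ⊤
  · rw [ht, EReal.top_add_coe] at h
    exact absurd (top_le_iff.1 h) (EReal.coe_ne_top _)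
  · rw [fin_coe hb ht] at h ⊢
    norm_cast at h ⊢
    linarith

lemma gph_iff {φ : EuclideanSpace ℝ (Fin n) → EReal} {ρ : ℝ} (hb : ∀ x, φ x ≠ ⊥)
    {x v : EuclideanSpace ℝ (Fin n)} : (x, v) ∈ gphSubdiff ρ φ ↔
      ∃ p : ℝ, φ x = p ∧ ∀ u : EuclideanSpace ℝ (Fin n), ∀ q : ℝ, φ u = q →
        p + ⟪v, u - x⟫ - (ρ / 2) * ‖u - x‖ ^ 2 ≤ q := by
  constructor
  · rintro ⟨h1, h2⟩
    simp only at h1 h2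
    refine ⟨_, fin_coe hb h1, fun u q hq => ?_⟩
    have := h2 u
    rw [hq, fin_coe hb h1] at this
    norm_cast at this
    linarith
  · rintro ⟨p, hp, h⟩
    refine ⟨by simp [hp], fun u => ?_⟩
    simp only
    by_cases hu : φ u = ⊤
    · simp [hu]
    · have := h u _ (fin_coe hb hu)
      rw [fin_coe hb hu, hp]
      norm_cast
      linarith

/-- linear lower growth of `shiftFun`. -/
lemma lower_growth {φ : EuclideanSpace ℝ (Fin n) → EReal} {ρ : ℝ} (hρ : 0 ≤ ρ)
    (hb : ∀ x, φ x ≠ ⊥) (hl : LowerSemicontinuous φ)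
    (hc : ERealConvex (shiftFun ρ φ)) {x₀ : EuclideanSpace ℝ (Fin n)} {p : ℝ}
    (hx : φ x₀ = p) : ∃ C : ℝ, 0 ≤ C ∧ ∀ w q, φ w = (q : ℝ) →
      p - C - C * ‖w - x₀‖ - ρ / 2 * ‖w - x₀‖ ^ 2 ≤ q := by
  obtain ⟨m, hm, hmin⟩ := (hl.lowerSemicontinuousOn (Metric.closedBall x₀ 1)).exists_isMinOn
    ⟨x₀, by simp⟩ (isCompact_closedBall x₀ 1)
  have hmt : φ m ≠ ⊤ := by
    have : φ m ≤ φ x₀ := hmin (by simp)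
    rw [hx] at this
    exact ne_top_of_le_ne_top (EReal.coe_ne_top _) this
  set μ := (φ m).toReal with hμ
  have hmμ : φ m = μ := fin_coe hb hmt
  have hμp : μ ≤ p := by
    have : φ m ≤ φ x₀ := hmin (by simp)
    rw [hx, hmμ] at this
    exact_mod_cast this
  refine ⟨p - μ, by linarith, fun w q hq => ?_⟩
  by_cases hw : ‖w - x₀‖ ≤ 1
  · have : φ m ≤ φ w := hmin (by simpa [dist_eq_norm] using hw)
    rw [hq, hmμ] at this
    have : μ ≤ q := by exact_mod_cast this
    nlinarith [mul_nonneg (sub_nonneg.2 hμp) (norm_nonneg (w - x₀)),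
      mul_nonneg hρ (sq_nonneg ‖w - x₀‖)]
  · push Not at hw
    set r := ‖w - x₀‖ with hr
    have hr0 : 0 < r := by linarith
    have h1 : 0 ≤ 1 - r⁻¹ := sub_nonneg.2 (inv_le_one_of_one_le₀ hw.le)
    have h := wc_real hb hc hx hq h1 (inv_nonneg.2 hr0.le) (by ring)
    have h2 : φ m ≤ φ ((1 - r⁻¹) • x₀ + r⁻¹ • w) := by
      apply hmin
      have : (1 - r⁻¹) • x₀ + r⁻¹ • w - x₀ = r⁻¹ • (w - x₀) := by module
      simp only [Metric.mem_closedBall, dist_eq_norm]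
      rw [this, norm_smul, ← hr, Real.norm_eq_abs, abs_of_pos (inv_pos.2 hr0)]
      exact (inv_mul_cancel₀ hr0.ne').le
    have h3 := h2.trans h
    rw [hmμ, norm_sub_rev, ← hr] at h3
    have h4 : μ ≤ (1 - r⁻¹) * p + r⁻¹ * q + ρ / 2 * ((1 - r⁻¹) * r⁻¹) * r ^ 2 := by
      exact_mod_cast h3
    have h5 := mul_le_mul_of_nonneg_left h4 hr0.le
    have h6 : r * ((1 - r⁻¹) * p + r⁻¹ * q + ρ / 2 * ((1 - r⁻¹) * r⁻¹) * r ^ 2)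
      = (r - 1) * p + q + ρ / 2 * (r - 1) * r := by
      field_simp
    rw [h6] at h5
    nlinarith [mul_nonneg hρ hr0.le]

lemma exists_prox {φ : EuclideanSpace ℝ (Fin n) → EReal} {ρ : ℝ} (hρ : 0 ≤ ρ)
    (hb : ∀ x, φ x ≠ ⊥) (hp : ∃ x, φ x ≠ ⊤) (hl : LowerSemicontinuous φ)
    (hc : ERealConvex (shiftFun ρ φ)) {κ : ℝ} (hκ : ρ < κ) (u : EuclideanSpace ℝ (Fin n)) :
    ∃ x, (x, κ • (u - x)) ∈ gphSubdiff ρ φ := by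
  obtain ⟨x₀, hx₀⟩ := hp
  set p := (φ x₀).toReal with hpdef
  have hx₀p : φ x₀ = p := fin_coe hb hx₀
  obtain ⟨C, hC, hgrow⟩ := lower_growth hρ hb hl hc hx₀p
  set d := ‖x₀ - u‖ with hd
  set h : EuclideanSpace ℝ (Fin n) → EReal := fun w => φ w + ((κ / 2 * ‖w - u‖ ^ 2 : ℝ) : EReal)
    with hh
  have hlsc : LowerSemicontinuous h := by
    apply LowerSemicontinuous.add' hl
    · apply Continuous.lowerSemicontinuous
      exact continuous_coe_real_ereal.comp (by fun_prop)
    · intro w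
      exact EReal.continuousAt_add (Or.inr (EReal.coe_ne_bot _)) (Or.inr (EReal.coe_ne_top _))
  obtain ⟨R, hR0, hR⟩ : ∃ R : ℝ, 0 ≤ R ∧ ∀ r, R < r →
      κ / 2 * d ^ 2 < - C - C * r - ρ / 2 * r ^ 2 + κ / 2 * (r - d) ^ 2 := by
    have hδ : 0 < (κ - ρ) / 2 := by linarith
    have hd0 : 0 ≤ d := norm_nonneg _
    have hA : 0 ≤ κ * d := mul_nonneg (by linarith) hd0
    refine ⟨(C + κ * d + C) / ((κ - ρ) / 2) + 1, by positivity, fun r hr => ?_⟩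
    have hq : 0 ≤ (C + κ * d + C) / ((κ - ρ) / 2) := by positivity
    have hr1 : 1 < r := by linarith
    have h1 : C + κ * d + C < r * ((κ - ρ) / 2) := by
      rw [← div_lt_iff₀ hδ]; linarith
    have h2 := mul_lt_mul_of_pos_left h1 (show 0 < r by linarith)
    nlinarith [mul_nonneg hC (show 0 ≤ r - 1 by linarith)]
  obtain ⟨m, hm, hmin⟩ := (hlsc.lowerSemicontinuousOn (Metric.closedBall x₀ R)).exists_isMinOn
    ⟨x₀, by simpa using hR0⟩ (isCompact_closedBall x₀ R)
  have hm0 : h m ≤ h x₀ := hmin (by simpa using hR0)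
  have hglob : ∀ w, h m ≤ h w := by
    intro w
    by_cases hw : ‖w - x₀‖ ≤ R
    · exact hmin (by simpa [dist_eq_norm] using hw)
    · refine hm0.trans ?_
      by_cases hwt : φ w = ⊤
      · simp only [hh, hwt, EReal.top_add_coe, le_top]
      have hwq := fin_coe hb hwt
      have hg := hgrow w _ hwq
      have h2 := hR _ (not_le.1 hw)
      simp only [hh]
      rw [hwq, hx₀p]
      norm_cast
      have h3 : |‖w - x₀‖ - d| ≤ ‖w - u‖ := by
        have := abs_norm_sub_norm_le (w - x₀) (u - x₀)
        rw [norm_sub_rev u x₀] at this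
        simpa using this
      have h4 : (‖w - x₀‖ - d) ^ 2 ≤ ‖w - u‖ ^ 2 := by
        rw [← sq_abs (‖w - x₀‖ - d)]
        exact pow_le_pow_left₀ (abs_nonneg _) h3 2
      have h5 := mul_le_mul_of_nonneg_left h4 (show 0 ≤ κ / 2 by linarith)
      linarith
  have hmt : φ m ≠ ⊤ := by
    intro ht
    simp only [hh, ht, hx₀p, EReal.top_add_coe, top_le_iff] at hm0
    exact EReal.coe_ne_top _ (by exact_mod_cast hm0)
  have hmμ := fin_coe hb hmt
  set μ := (φ m).toReal
  refine ⟨m, (gph_iff hb).2 ⟨μ, hmμ, fun w q hq => ?_⟩⟩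
  have key : ∀ t : ℝ, 0 < t → t < 1 → 
      μ + ⟪κ • (u - m), w - m⟫ - (ρ / 2) * ‖w - m‖ ^ 2 - t * ((κ - ρ) / 2 * ‖w - m‖ ^ 2)  ≤ q := by
    intro t ht ht1
    have h1 := wc_real hb hc hmμ hq (sub_nonneg.2 ht1.le) ht.le (by ring)
    have h2 := (hglob ((1 - t) • m + t • w)).trans (add_le_add_left h1 _)
    simp only [hh] at h2
    rw [hmμ] at h2
    norm_cast at h2
    have e : (1 - t) • m + t • w - u = (m - u) + t • (w - m) := by module
    rw [e, norm_add_sq_real (m - u), real_inner_smul_right, norm_smul, mul_pow, Real.norm_eq_abs,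
      sq_abs, norm_sub_rev m w] at h2
    have e2 : ⟪m - u, w - m⟫ = - ⟪u - m, w - m⟫ := by
      rw [← inner_neg_left, neg_sub]
    rw [e2] at h2
    rw [real_inner_smul_left]
    refine le_of_mul_le_mul_left ?_ ht
    linarith
  have hlim : Tendsto (fun t : ℝ => μ + ⟪κ • (u - m), w - m⟫ - (ρ / 2) * ‖w - m‖ ^ 2
      - t * ((κ - ρ) / 2 * ‖w - m‖ ^ 2)) (𝓝[>] 0) (𝓝 (μ + ⟪κ • (u - m), w - m⟫
      - (ρ / 2) * ‖w - m‖ ^ 2 - 0 * ((κ - ρ) / 2 * ‖w - m‖ ^ 2))) :=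
    (Continuous.tendsto (by fun_prop) 0).mono_left nhdsWithin_le_nhds
  rw [zero_mul, sub_zero] at hlim
  refine le_of_tendsto hlim ?_
  filter_upwards [Ioo_mem_nhdsGT (zero_lt_one (α := ℝ))] with t ht using key t ht.1 ht.2

lemma hypo {φ : EuclideanSpace ℝ (Fin n) → EReal} {ρ : ℝ} (hb : ∀ x, φ x ≠ ⊥)
    {x v x' v' : EuclideanSpace ℝ (Fin n)} (h : (x, v) ∈ gphSubdiff ρ φ)
    (h' : (x', v') ∈ gphSubdiff ρ φ) : - ρ * ‖x' - x‖ ^ 2 ≤ ⟪v' - v, x' - x⟫ := by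
  obtain ⟨p, hp, hs⟩ := (gph_iff hb).1 h
  obtain ⟨p', hp', hs'⟩ := (gph_iff hb).1 h'
  have h1 := hs x' p' hp'
  have h2 := hs' x p hp
  rw [norm_sub_rev x x', ← neg_sub x' x, inner_neg_right] at h2
  rw [inner_sub_left]
  linarith

lemma prox_lip {φ : EuclideanSpace ℝ (Fin n) → EReal} {ρ : ℝ} (hρ : 0 ≤ ρ)
    (hb : ∀ x, φ x ≠ ⊥) {x u x' u' : EuclideanSpace ℝ (Fin n)}
    (h : (x, (ρ + 1) • (u - x)) ∈ gphSubdiff ρ φ)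
    (h' : (x', (ρ + 1) • (u' - x')) ∈ gphSubdiff ρ φ) :
    ‖x' - x‖ ≤ (ρ + 1) * ‖u' - u‖ := by
  have h1 := hypo hb h h'
  have e : (ρ + 1) • (u' - x') - (ρ + 1) • (u - x) = (ρ + 1) • ((u' - u) - (x' - x)) := by module
  rw [e, real_inner_smul_left, inner_sub_left, real_inner_self_eq_norm_sq] at h1
  have h2 := mul_le_mul_of_nonneg_left (real_inner_le_norm (u' - u) (x' - x))
    (show 0 ≤ ρ + 1 by linarith)
  by_cases h0 : ‖x' - x‖ = 0
  · rw [h0]; positivity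
  · have h3 : 0 < ‖x' - x‖ := lt_of_le_of_ne (norm_nonneg _) (Ne.symm h0)
    refine le_of_mul_le_mul_right ?_ h3
    nlinarith

/-- The reflected resolvent is nonexpansive. -/
lemma reflected {φ : EuclideanSpace ℝ (Fin n) → EReal} {ρ : ℝ} (hρ : 0 ≤ ρ)
    (hb : ∀ x, φ x ≠ ⊥)
    (htan : ∀ x y : EuclideanSpace ℝ (Fin n), (x, y) ∈ gphSubdiff ρ φ →
          ∀ w z : EuclideanSpace ℝ (Fin n),
            (w, z) ∈ contTangentCone (gphSubdiff ρ φ) (x, y) → 0 ≤ ⟪z, w⟫)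
    {P : EuclideanSpace ℝ (Fin n) → EuclideanSpace ℝ (Fin n)}
    (hP : ∀ u, (P u, (ρ + 1) • (u - P u)) ∈ gphSubdiff ρ φ) (u d : EuclideanSpace ℝ (Fin n)) :
    ‖(2 : ℝ) • (P (u + d) - P u) - d‖ ≤ ‖d‖ := by
  have hκ : 0 < ρ + 1 := by linarith
  have hlip : ∀ a b, ‖P b - P a‖ ≤ (ρ + 1) * ‖b - a‖ := fun a b => prox_lip hρ hb (hP a) (hP b)
  have hPc : Continuous P := by
    refine (LipschitzWith.of_dist_le_mul (K := ⟨ρ + 1, hκ.le⟩) fun a b => ?_).continuous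
    rw [dist_eq_norm, dist_eq_norm]
    exact hlip b a
  set G : ℝ → EuclideanSpace ℝ (Fin n) := fun s => (2 : ℝ) • (P (u + s • d) - P u) - s • d with hG
  have hGc : Continuous G := by fun_prop
  have main := image_le_of_liminf_slope_right_le_deriv_boundary (f := fun s => ‖G s‖) (a := 0)
    (b := 1) hGc.norm.continuousOn (B := fun s => s * ‖d‖) (B' := fun _ => ‖d‖)
    (by simp [hG]) (by fun_prop)
    (fun x _ => by simpa using ((hasDerivAt_id x).mul_const ‖d‖).hasDerivWithinAt)
    (by
      intro s _ r hr
      set τ : ℕ → ℝ := fun k => 1 / ((k : ℝ) + 1) with hτ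
      have hτ0 : ∀ k, 0 < τ k := fun k => by positivity
      have hτl : Tendsto τ atTop (𝓝 0) := tendsto_one_div_add_atTop_nhds_zero_nat
      set W : ℕ → EuclideanSpace ℝ (Fin n) :=
        fun k => (τ k)⁻¹ • (P (u + (s + τ k) • d) - P (u + s • d)) with hW
      have hWb : ∀ k, W k ∈ Metric.closedBall (0 : EuclideanSpace ℝ (Fin n)) ((ρ + 1) * ‖d‖) := by
        intro k
        rw [mem_closedBall_zero_iff, hW]
        simp only
        rw [norm_smul, norm_inv, Real.norm_eq_abs, abs_of_pos (hτ0 k), inv_mul_le_iff₀ (hτ0 k)]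
        refine (hlip _ _).trans (le_of_eq ?_)
        have : u + (s + τ k) • d - (u + s • d) = τ k • d := by module
        rw [this, norm_smul, Real.norm_eq_abs, abs_of_pos (hτ0 k)]
        ring
      obtain ⟨w, -, ψ, hψ, hψl⟩ := tendsto_subseq_of_bounded Metric.isBounded_closedBall hWb
      have hin := htan (P (u + s • d)) _ (hP _) w ((ρ + 1) • (d - w)) ⟨τ ∘ ψ,
        fun k => (W (ψ k), (ρ + 1) • (d - W (ψ k))), fun k => hτ0 _, hτl.comp hψ.tendsto_atTop,
        hψl.prodMk_nhds ((tendsto_const_nhds.sub hψl).const_smul (ρ + 1)), fun k => by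
          have e1 : τ (ψ k) • W (ψ k) = P (u + (s + τ (ψ k)) • d) - P (u + s • d) := by
            simp only [hW]
            rw [smul_smul, mul_inv_cancel₀ (hτ0 _).ne', one_smul]
          convert hP (u + (s + τ (ψ k)) • d) using 1
          simp only [Function.comp, Prod.smul_mk, Prod.mk_add_mk]
          rw [smul_comm (τ (ψ k)) (ρ + 1), smul_sub (τ (ψ k)), e1]
          refine Prod.ext ?_ ?_
          · simp
          · simp only
            module⟩
      rw [real_inner_smul_left, inner_sub_left, real_inner_self_eq_norm_sq] at hin
      have hin2 : 0 ≤ ⟪d, w⟫ - ‖w‖ ^ 2 := nonneg_of_mul_nonneg_right hin hκ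
      have hle : ‖(2 : ℝ) • w - d‖ ≤ ‖d‖ := by
        refine le_of_sq_le_sq ?_ (norm_nonneg _)
        rw [norm_sub_sq_real, norm_smul, real_inner_smul_left, real_inner_comm]
        norm_num
        nlinarith
      have hlim : Tendsto (fun k => ‖(2 : ℝ) • W (ψ k) - d‖) atTop (𝓝 ‖(2 : ℝ) • w - d‖) :=
        ((hψl.const_smul (2 : ℝ)).sub_const d).norm
      have hev := hlim.eventually_lt_const (lt_of_le_of_lt hle hr)
      have hst : Tendsto (fun k => s + τ (ψ k)) atTop (𝓝[>] s) := by
        refine tendsto_nhdsWithin_iff.2 ⟨?_, Eventually.of_forall fun k => ?_⟩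
        · simpa using (hτl.comp hψ.tendsto_atTop).const_add s
        · simpa using hτ0 (ψ k)
      refine hst.frequently (Eventually.frequently ?_)
      filter_upwards [hev] with k hk
      refine lt_of_le_of_lt ?_ hk
      rw [slope_def_field, div_le_iff₀ (by simpa using hτ0 (ψ k))]
      refine (norm_sub_norm_le _ _).trans (le_of_eq ?_)
      have e1 : τ (ψ k) • W (ψ k) = P (u + (s + τ (ψ k)) • d) - P (u + s • d) := by
        simp only [hW]
        rw [smul_smul, mul_inv_cancel₀ (hτ0 _).ne', one_smul]
      have e2 : G (s + τ (ψ k)) - G s = τ (ψ k) • ((2 : ℝ) • W (ψ k) - d) := by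
        rw [smul_sub, smul_comm, e1]
        simp only [hG]
        module
      rw [e2, norm_smul, Real.norm_eq_abs, abs_of_pos (hτ0 _)]
      ring)
  have := main (show (1 : ℝ) ∈ Icc 0 1 by simp)
  simpa [hG] using this

lemma global_sub {φ : EuclideanSpace ℝ (Fin n) → EReal} {ρ : ℝ} (hρ : 0 ≤ ρ)
    (hb : ∀ x, φ x ≠ ⊥) (hp : ∃ x, φ x ≠ ⊤) (hl : LowerSemicontinuous φ)
    (hc : ERealConvex (shiftFun ρ φ))
    (htan : ∀ x y : EuclideanSpace ℝ (Fin n), (x, y) ∈ gphSubdiff ρ φ →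
          ∀ w z : EuclideanSpace ℝ (Fin n),
            (w, z) ∈ contTangentCone (gphSubdiff ρ φ) (x, y) → 0 ≤ ⟪z, w⟫)
    {x v w : EuclideanSpace ℝ (Fin n)} (hxv : (x, v) ∈ gphSubdiff ρ φ) {p q : ℝ}
    (hx : φ x = p) (hw : φ w = q) : p + ⟪v, w - x⟫ ≤ q := by
  have hκ : 0 < ρ + 1 := by linarith
  choose P hP using fun u => exists_prox hρ hb hp hl hc (lt_add_one ρ) u
  have hrefl := reflected hρ hb htan hP
  have hfin : ∀ u, φ (P u) = ((φ (P u)).toReal : EReal) := fun u => fin_coe hb (hP u).1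
  set e : EuclideanSpace ℝ (Fin n) → ℝ :=
    fun u => (φ (P u)).toReal + (ρ + 1) / 2 * ‖u - P u‖ ^ 2 with he
  have hmin : ∀ u w (q : ℝ), φ w = q → e u ≤ q + (ρ + 1) / 2 * ‖u - w‖ ^ 2 := by
    intro u w q hq
    obtain ⟨p, hp, hs⟩ := (gph_iff hb).1 (hP u)
    have h1 := hs w q hq
    have h2 : (φ (P u)).toReal = p := by rw [hp]; rfl
    simp only [he, h2]
    have : u - w = (u - P u) - (w - P u) := by abel
    rw [this, norm_sub_sq_real (u - P u)]
    rw [real_inner_smul_left] at h1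
    nlinarith [sq_nonneg ‖w - P u‖]
  have hup : ∀ u u', e u' ≤ e u + (ρ + 1) * ⟪u - P u, u' - u⟫ + (ρ + 1) / 2 * ‖u' - u‖ ^ 2 := by
    intro u u'
    have h1 := hmin u' (P u) _ (hfin u)
    have : u' - P u = (u - P u) + (u' - u) := by abel
    rw [this, norm_add_sq_real] at h1
    simp only [he] at h1 ⊢
    linarith
  have hmono : ∀ u u', ⟪u - P u, u' - u⟫ ≤ ⟪u' - P u', u' - u⟫ := by
    intro u u'
    have h1 := hrefl u (u' - u)
    rw [add_sub_cancel] at h1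
    have h2 := pow_le_pow_left₀ (norm_nonneg _) h1 2
    rw [norm_sub_sq_real, norm_smul, real_inner_smul_left] at h2
    norm_num at h2
    have h3 : ⟪u' - P u', u' - u⟫ - ⟪u - P u, u' - u⟫ = ‖u' - u‖ ^ 2 - ⟪P u' - P u, u' - u⟫ := by
      rw [← real_inner_self_eq_norm_sq, ← inner_sub_left, ← inner_sub_left]
      congr 1; abel
    have h4 : ‖P u' - P u‖ ^ 2 ≤ ⟪P u' - P u, u' - u⟫ := by nlinarith
    have h5 := norm_sub_sq_real (P u' - P u) (u' - u)
    nlinarith [sq_nonneg ‖P u' - P u - (u' - u)‖]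
  have hlow : ∀ k : ℕ, ∀ u u', e u + (ρ + 1) * ⟪u - P u, u' - u⟫
      - ((ρ + 1) / 2 * (1 / 2) ^ k) * ‖u' - u‖ ^ 2 ≤ e u' := by
    intro k
    induction k with
    | zero =>
      intro u u'
      have h1 := hup u' u
      have h2 := mul_le_mul_of_nonneg_left (hmono u u') hκ.le
      rw [norm_sub_rev u u', ← neg_sub u' u, inner_neg_right] at h1
      simp only [pow_zero, mul_one]
      linarith
    | succ k ih =>
      intro u u'
      set m := u + (1 / 2 : ℝ) • (u' - u) with hm
      have e1 : m - u = (1 / 2 : ℝ) • (u' - u) := by rw [hm]; abel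
      have e2 : u' - m = (1 / 2 : ℝ) • (u' - u) := by rw [hm]; module
      have h1 := ih u m
      have h2 := ih m u'
      have h3 := hmono u m
      rw [e1, norm_smul, mul_pow, real_inner_smul_right] at h1
      rw [e2, norm_smul, mul_pow, real_inner_smul_right] at h2
      rw [e1, real_inner_smul_right, real_inner_smul_right] at h3
      norm_num at h1 h2 h3
      have h4 := mul_le_mul_of_nonneg_left h3 hκ.le
      rw [pow_succ]
      norm_num
      linarith
  have hconv : ∀ u u', e u + (ρ + 1) * ⟪u - P u, u' - u⟫ ≤ e u' := by
    intro u u'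
    have hlim : Tendsto (fun k : ℕ => e u + (ρ + 1) * ⟪u - P u, u' - u⟫
      - ((ρ + 1) / 2 * (1 / 2) ^ k) * ‖u' - u‖ ^ 2) atTop (𝓝 (e u + (ρ + 1) * ⟪u - P u, u' - u⟫
      - ((ρ + 1) / 2 * 0) * ‖u' - u‖ ^ 2)) :=
      tendsto_const_nhds.sub (((tendsto_pow_atTop_nhds_zero_of_lt_one (by norm_num)
        (by norm_num)).const_mul _).mul_const _)
    rw [mul_zero, zero_mul, sub_zero] at hlim
    exact le_of_tendsto' hlim fun k => hlow k u u'
  set u := x + (ρ + 1)⁻¹ • v with hu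
  have hv : v = (ρ + 1) • (u - x) := by
    rw [hu, add_sub_cancel_left, smul_smul, mul_inv_cancel₀ hκ.ne', one_smul]
  have hPu : P u = x := by
    rw [hv] at hxv
    have := prox_lip hρ hb hxv (hP u)
    rw [sub_self, norm_zero, mul_zero] at this
    exact sub_eq_zero.1 (norm_le_zero_iff.1 this)
  have h1 := hconv u (u + (w - x))
  have h2 := hmin (u + (w - x)) w q hw
  have e3 : u + (w - x) - w = u - x := by abel
  rw [e3] at h2
  simp only [add_sub_cancel_left] at h1
  have h3 : e u = p + (ρ + 1) / 2 * ‖u - x‖ ^ 2 := by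
    simp only [he, hPu, hx, EReal.toReal_coe]
  rw [hPu] at h1
  rw [hv, real_inner_smul_left]
  linarith

lemma convex_of_tan {φ : EuclideanSpace ℝ (Fin n) → EReal} {ρ : ℝ} (hρ : 0 ≤ ρ)
    (hb : ∀ x, φ x ≠ ⊥) (hp : ∃ x, φ x ≠ ⊤) (hl : LowerSemicontinuous φ)
    (hc : ERealConvex (shiftFun ρ φ))
    (htan : ∀ x y : EuclideanSpace ℝ (Fin n), (x, y) ∈ gphSubdiff ρ φ →
          ∀ w z : EuclideanSpace ℝ (Fin n),
            (w, z) ∈ contTangentCone (gphSubdiff ρ φ) (x, y) → 0 ≤ ⟪z, w⟫) :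
    ERealConvex φ := by
  have hg := @global_sub n φ ρ hρ hb hp hl hc htan
  intro x y a b ha hb' hab
  rcases ha.eq_or_lt with rfl | ha
  · obtain rfl : b = 1 := by linarith
    simp
  rcases hb'.eq_or_lt with rfl | hb'
  · obtain rfl : a = 1 := by linarith
    simp
  by_cases hx : φ x = ⊤
  · rw [hx, EReal.coe_mul_top_of_pos ha, EReal.top_add_of_ne_bot]
    · exact le_top
    · by_cases hy : φ y = ⊤
      · rw [hy, EReal.coe_mul_top_of_pos hb']; simp
      · rw [fin_coe hb hy, ← EReal.coe_mul]; exact EReal.coe_ne_bot _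
  have hxp := fin_coe hb hx
  by_cases hy : φ y = ⊤
  · rw [hy, EReal.coe_mul_top_of_pos hb', EReal.add_top_of_ne_bot]
    · exact le_top
    · rw [hxp, ← EReal.coe_mul]; exact EReal.coe_ne_bot _
  have hyq := fin_coe hb hy
  set p := (φ x).toReal
  set q := (φ y).toReal
  rw [hxp, hyq]
  norm_cast
  set z := a • x + b • y with hz
  set c := a * p + b * q with hcdef
  obtain ⟨x₁, hx₁⟩ := exists_prox hρ hb hp hl hc (lt_add_one ρ) 0
  set v₁ := (ρ + 1) • (0 - x₁)
  have hx₁f := fin_coe hb hx₁.1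
  simp only at hx₁f
  set p₁ := (φ x₁).toReal
  choose Z hZ using fun k : ℕ => exists_prox hρ hb hp hl hc
    (show ρ < ρ + 2 + k by have : (0 : ℝ) ≤ k := k.cast_nonneg
                           linarith) z
  have hZf : ∀ k, φ (Z k) = ((φ (Z k)).toReal : EReal) := fun k => fin_coe hb (hZ k).1
  have hle : ∀ k : ℕ, (φ (Z k)).toReal + (ρ + 2 + k) * ‖z - Z k‖ ^ 2 ≤ c := by
    intro k
    have h1 := hg (hZ k) (hZf k) hxp
    have h2 := hg (hZ k) (hZf k) hyq
    have h3 : ⟪(ρ + 2 + (k : ℝ)) • (z - Z k), z - Z k⟫ =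
        a * ⟪(ρ + 2 + (k : ℝ)) • (z - Z k), x - Z k⟫
          + b * ⟪(ρ + 2 + (k : ℝ)) • (z - Z k), y - Z k⟫ := by
      rw [← real_inner_smul_right _ _ a, ← real_inner_smul_right _ _ b, ← inner_add_right]
      congr 1
      have : b = 1 - a := by linarith
      rw [hz, this]; module
    rw [real_inner_smul_left, real_inner_self_eq_norm_sq] at h3
    rw [h3]
    have h4 := add_le_add (mul_le_mul_of_nonneg_left h1 ha.le)
      (mul_le_mul_of_nonneg_left h2 hb'.le)
    have h5 : (φ (Z k)).toReal = a * (φ (Z k)).toReal + b * (φ (Z k)).toReal := by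
      rw [← add_mul, hab, one_mul]
    linarith
  set K := c - p₁ - ⟪v₁, z - x₁⟫ + ‖v₁‖ ^ 2 with hK
  have hbd : ∀ k : ℕ, ‖z - Z k‖ ^ 2 ≤ K * (1 / ((k : ℝ) + 1)) := by
    intro k
    have hk : (0 : ℝ) < (k : ℝ) + 1 := by positivity
    have h1 := hg hx₁ hx₁f (hZf k)
    have h2 : ⟪v₁, Z k - x₁⟫ = ⟪v₁, z - x₁⟫ - ⟪v₁, z - Z k⟫ := by
      rw [← inner_sub_right]; congr 1; abel
    have h3 := real_inner_le_norm v₁ (z - Z k)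
    have h4 := hle k
    rw [h2] at h1
    rw [mul_one_div, le_div_iff₀ hk]
    nlinarith [sq_nonneg (‖v₁‖ - ‖z - Z k‖), sq_nonneg ‖v₁‖, sq_nonneg ‖z - Z k‖,
      mul_nonneg hρ (sq_nonneg ‖z - Z k‖)]
  have hZl : Tendsto Z atTop (𝓝 z) := by
    have h1 : Tendsto (fun k : ℕ => K * (1 / ((k : ℝ) + 1))) atTop (𝓝 0) := by
      simpa using tendsto_one_div_add_atTop_nhds_zero_nat.const_mul K
    have h2 := squeeze_zero (fun k => sq_nonneg ‖z - Z k‖) hbd h1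
    have h3 := h2.sqrt
    simp only [Real.sqrt_sq (norm_nonneg _), Real.sqrt_zero] at h3
    rw [tendsto_iff_norm_sub_tendsto_zero]
    simpa only [norm_sub_rev] using h3
  by_contra hcon
  obtain ⟨k, hk⟩ := (hZl.eventually (hl z _ (not_le.1 hcon))).exists
  rw [hZf k] at hk
  have hk' : c < (φ (Z k)).toReal := by exact_mod_cast hk
  have := hle k
  have h0 : 0 ≤ (ρ + 2 + (k : ℝ)) * ‖z - Z k‖ ^ 2 := by positivity
  linarith

/-- a proper l.s.c. function is convex iff it is weakly convex and
tangent directions to the graph of its subdifferential satisfy ⟨z,w⟩ ≥ 0. -/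
theorem statement5 (n : ℕ) (φ : EuclideanSpace ℝ (Fin n) → EReal)
    (hnotbot : ∀ x, φ x ≠ ⊥) (hproper : ∃ x, φ x ≠ ⊤)
    (hlsc : LowerSemicontinuous φ) :
    ERealConvex φ ↔
      ∃ ρ : ℝ, 0 ≤ ρ ∧ ERealConvex (shiftFun ρ φ) ∧
        ∀ x y : EuclideanSpace ℝ (Fin n), (x, y) ∈ gphSubdiff ρ φ →
          ∀ w z : EuclideanSpace ℝ (Fin n),
            (w, z) ∈ contTangentCone (gphSubdiff ρ φ) (x, y) → 0 ≤ ⟪z, w⟫ := by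
  constructor
  · intro hc
    refine ⟨0, le_rfl, ?_, ?_⟩
    · have : shiftFun 0 φ = φ := by
        funext x
        simp [shiftFun]
      rwa [this]
    · rintro x y hxy w z ⟨t, ws, ht, -, hws, hmem⟩
      have h1 : Tendsto (fun k => ⟪(ws k).2, (ws k).1⟫) atTop (𝓝 ⟪z, w⟫) :=
        ((continuous_snd.tendsto (w, z)).comp hws).inner ((continuous_fst.tendsto (w, z)).comp hws)
      refine ge_of_tendsto' h1 fun k => ?_
      have h2 := hypo (x' := x + t k • (ws k).1) (v' := y + t k • (ws k).2) hnotbot hxy (hmem k)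
      rw [add_sub_cancel_left, add_sub_cancel_left, real_inner_smul_left, real_inner_smul_right,
        neg_zero, zero_mul, ← mul_assoc] at h2
      exact nonneg_of_mul_nonneg_right h2 (mul_pos (ht k) (ht k))
  · rintro ⟨ρ, hρ, hc, htan⟩
    exact convex_of_tan hρ hnotbot hproper hlsc hc htan

end
end

section
/- Let φ : ℝⁿ → ℝ ∪ {+∞} be proper, lower semicontinuous and ρ-weakly convex for some ρ ≥ 0, and let κ > 0. Then φ is strongly convex with modulus κ (i.e., x ↦ φ(x) − (κ/2)‖x‖² is convex) if and only if for every (x,y) ∈ gph ∂φ and every (w,z) ∈ T_{gph ∂φ}(x,y), one has ⟨z,w⟩ ≥ κ‖w‖². -/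
open scoped RealInnerProductSpace
open Filter Topology MeasureTheory Set

noncomputable section

variable {n : ℕ}

theorem aux_conv_iff (φ : EuclideanSpace ℝ (Fin n) → EReal) (hb : ∀ x, φ x ≠ ⊥) (σ : ℝ) :
    ERealConvex (shiftFun σ φ) ↔
      ConvexOn ℝ {x | φ x ≠ ⊤} (fun x => (φ x).toReal + σ / 2 * ‖x‖ ^ 2) := by
  have key : ∀ x, φ x ≠ ⊤ → shiftFun σ φ x =
      (((φ x).toReal + σ / 2 * ‖x‖ ^ 2 : ℝ) : EReal) := by
    intro x hx
    rw [EReal.coe_add, EReal.coe_toReal hx (hb x)]; rfl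
  have keytop : ∀ x, φ x = ⊤ → shiftFun σ φ x = ⊤ := by
    intro x hx
    simp only [shiftFun, hx, EReal.top_add_coe]
  have hnb : ∀ x, shiftFun σ φ x ≠ ⊥ := by
    intro x
    by_cases hx : φ x = ⊤
    · rw [keytop x hx]; simp
    · rw [key x hx]; exact EReal.coe_ne_bot _
  constructor
  · intro h
    have h' : ∀ x, φ x ≠ ⊤ → ∀ y, φ y ≠ ⊤ → ∀ a b : ℝ, 0 ≤ a → 0 ≤ b → a + b = 1 →
        shiftFun σ φ (a • x + b • y) ≤ ((a * ((φ x).toReal + σ / 2 * ‖x‖ ^ 2) +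
          b * ((φ y).toReal + σ / 2 * ‖y‖ ^ 2) : ℝ) : EReal) := by
      intro x hx y hy a b ha hb' hab
      have := h x y a b ha hb' hab
      rw [key x hx, key y hy] at this
      exact_mod_cast this
    have hdom : ∀ x, φ x ≠ ⊤ → ∀ y, φ y ≠ ⊤ → ∀ a b : ℝ, 0 ≤ a → 0 ≤ b → a + b = 1 →
        φ (a • x + b • y) ≠ ⊤ := by
      intro x hx y hy a b ha hb' hab htop
      have := h' x hx y hy a b ha hb' hab
      rw [keytop _ htop, top_le_iff] at this
      exact EReal.coe_ne_top _ this
    refine ⟨fun x hx y hy a b ha hb' hab => hdom x hx y hy a b ha hb' hab, ?_⟩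
    intro x hx y hy a b ha hb' hab
    have := h' x hx y hy a b ha hb' hab
    rw [key _ (hdom x hx y hy a b ha hb' hab)] at this
    exact_mod_cast this
  · intro h x y a b ha hb' hab
    rcases ha.eq_or_lt with rfl | ha
    · have : b = 1 := by linarith
      subst this; simp
    rcases hb'.eq_or_lt with rfl | hb'
    · have : a = 1 := by linarith
      subst this; simp
    by_cases hx : φ x = ⊤
    · rw [keytop x hx, EReal.coe_mul_top_of_pos ha, EReal.top_add_of_ne_bot]
      · exact le_top
      · by_cases hy : φ y = ⊤
        · rw [keytop y hy, EReal.coe_mul_top_of_pos hb']; simp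
        · rw [key y hy, ← EReal.coe_mul]; exact EReal.coe_ne_bot _
    by_cases hy : φ y = ⊤
    · rw [keytop y hy, EReal.coe_mul_top_of_pos hb', EReal.add_top_of_ne_bot]
      · exact le_top
      · rw [key x hx, ← EReal.coe_mul]; exact EReal.coe_ne_bot _
    have h1 := h.1 hx hy ha.le hb'.le hab
    have h2 := h.2 hx hy ha.le hb'.le hab
    rw [key _ h1, key x hx, key y hy]
    exact_mod_cast h2

theorem aux_mem_gph (φ : EuclideanSpace ℝ (Fin n) → EReal) (hb : ∀ x, φ x ≠ ⊥) (ρ : ℝ)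
    (x y : EuclideanSpace ℝ (Fin n)) :
    (x, y) ∈ gphSubdiff ρ φ ↔ φ x ≠ ⊤ ∧ ∀ u, φ u ≠ ⊤ →
      (φ x).toReal + (⟪y, u - x⟫ - ρ / 2 * ‖u - x‖ ^ 2) ≤ (φ u).toReal := by
  show (φ x ≠ ⊤ ∧ ∀ u, φ x + ((⟪y, u - x⟫ - (ρ / 2) * ‖u - x‖ ^ 2 : ℝ) : EReal) ≤ φ u) ↔ _
  refine and_congr_right fun hx => forall_congr' fun u => ?_
  by_cases hu : φ u = ⊤
  · simp [hu]
  · simp only [ne_eq, hu, not_false_eq_true, forall_const]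
    rw [← EReal.coe_le_coe_iff, EReal.coe_add, EReal.coe_toReal hx (hb x),
      EReal.coe_toReal hu (hb u)]

/-- limit helper -/
theorem aux_lim {A B : ℝ} (h : ∀ t : ℝ, 0 < t → t < 1 → A ≤ t * B) : A ≤ 0 := by
  have h1 : Tendsto (fun t : ℝ => t * B) (𝓝[>] 0) (𝓝 (0 * B)) :=
    ((continuous_id.mul continuous_const).tendsto 0).mono_left nhdsWithin_le_nhds
  rw [zero_mul] at h1
  refine ge_of_tendsto h1 ?_
  filter_upwards [Ioo_mem_nhdsGT (show (0 : ℝ) < 1 by norm_num)] with t ht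
  exact h t ht.1 ht.2

theorem aux_quad {E : Type*} [NormedAddCommGroup E] [InnerProductSpace ℝ E]
    (x u : E) (t : ℝ) : ‖(1 - t) • x + t • u‖ ^ 2 =
      (1 - t) * ‖x‖ ^ 2 + t * ‖u‖ ^ 2 - t * (1 - t) * ‖u - x‖ ^ 2 := by
  rw [norm_add_sq_real, norm_sub_sq_real, norm_smul, norm_smul, inner_smul_left, inner_smul_right,
    mul_pow, mul_pow, Real.norm_eq_abs, Real.norm_eq_abs, sq_abs, sq_abs, real_inner_comm x u]
  simp only [conj_trivial]
  ring

theorem aux_forward (φ : EuclideanSpace ℝ (Fin n) → EReal) (hb : ∀ x, φ x ≠ ⊥) (ρ κ : ℝ)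
    (hc : ConvexOn ℝ {x | φ x ≠ ⊤} (fun x => (φ x).toReal + (-κ) / 2 * ‖x‖ ^ 2))
    (x y : EuclideanSpace ℝ (Fin n)) (h : (x, y) ∈ gphSubdiff ρ φ) (u : EuclideanSpace ℝ (Fin n))
    (hu : φ u ≠ ⊤) :
    (φ x).toReal + ⟪y, u - x⟫ + κ / 2 * ‖u - x‖ ^ 2 ≤ (φ u).toReal := by
  rw [aux_mem_gph φ hb] at h
  obtain ⟨hx, h⟩ := h
  suffices (φ x).toReal + ⟪y, u - x⟫ + κ / 2 * ‖u - x‖ ^ 2 - (φ u).toReal ≤ 0 by linarith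
  refine aux_lim (B := (ρ + κ) / 2 * ‖u - x‖ ^ 2) ?_
  intro t ht0 ht1
  have h1 := hc.2 hx hu (show 0 ≤ 1 - t by linarith) ht0.le (by ring)
  have h2 := h _ (hc.1 hx hu (show 0 ≤ 1 - t by linarith) ht0.le (by ring))
  have e : (1 - t) • x + t • u - x = t • (u - x) := by module
  rw [e, inner_smul_right, norm_smul, mul_pow, Real.norm_eq_abs, sq_abs] at h2
  simp only [smul_eq_mul] at h1
  rw [aux_quad] at h1
  refine le_of_mul_le_mul_left ?_ ht0
  nlinarith

theorem aux_forward' (φ : EuclideanSpace ℝ (Fin n) → EReal) (hb : ∀ x, φ x ≠ ⊥) (ρ κ : ℝ)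
    (hc : ConvexOn ℝ {x | φ x ≠ ⊤} (fun x => (φ x).toReal + (-κ) / 2 * ‖x‖ ^ 2))
    (x y : EuclideanSpace ℝ (Fin n)) (h : (x, y) ∈ gphSubdiff ρ φ) 
    (w z : EuclideanSpace ℝ (Fin n))
    (hw : (w, z) ∈ contTangentCone (gphSubdiff ρ φ) (x, y)) : κ * ‖w‖ ^ 2 ≤ ⟪z, w⟫ := by
  obtain ⟨t, ws, ht, -, hws, hk⟩ := hw
  have h1 : Tendsto (fun k => (ws k).1) atTop (𝓝 w) := (continuous_fst.tendsto _).comp hws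
  have h2 : Tendsto (fun k => (ws k).2) atTop (𝓝 z) := (continuous_snd.tendsto _).comp hws
  refine le_of_tendsto_of_tendsto' ((h1.norm.pow 2).const_mul κ) (h2.inner h1) ?_
  intro k
  have hk' : (x + t k • (ws k).1, y + t k • (ws k).2) ∈ gphSubdiff ρ φ := hk k
  have a1 := aux_forward φ hb ρ κ hc _ _ hk' x h.1
  have a2 := aux_forward φ hb ρ κ hc _ _ h (x + t k • (ws k).1) hk'.1
  have e1 : x - (x + t k • (ws k).1) = - (t k • (ws k).1) := by abel
  rw [e1, norm_neg, inner_neg_right, inner_add_left, inner_smul_right, inner_smul_left,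
    norm_smul, mul_pow, inner_smul_right, Real.norm_eq_abs, sq_abs] at a1
  rw [add_sub_cancel_left, inner_smul_right, norm_smul, mul_pow, Real.norm_eq_abs, sq_abs] at a2
  simp only [conj_trivial] at a1
  have : 0 < t k ^ 2 := pow_pos (ht k) 2
  refine le_of_mul_le_mul_left ?_ this
  nlinarith

theorem aux_riemann (Ef θ : ℝ → ℝ) (M : ℝ) (h1 : ∀ s t, Ef t + θ t * (s - t) ≤ Ef s)
    (h2 : ∀ t ∈ Icc (0 : ℝ) 1, θ 0 + M * t ≤ θ t) : Ef 0 + θ 0 + M / 2 ≤ Ef 1 := by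
  have hN : ∀ N : ℕ, Ef 0 + θ 0 + M / 2 - M / 2 * (1 / ((N : ℝ) + 1)) ≤ Ef 1 := by
    intro N
    set d : ℝ := 1 / ((N : ℝ) + 1) with hd
    have hd0 : 0 < d := by positivity
    have hdN : ((N : ℝ) + 1) * d = 1 := by rw [hd]; field_simp
    have hk : ∀ k : ℕ, k ≤ N + 1 →
        Ef 0 + (k * d) * θ 0 + M / 2 * (k * (k - 1)) * d ^ 2 ≤ Ef (k * d) := by
      intro k
      induction k with
      | zero => intro _; simp
      | succ k ih =>
        intro hk
        have i1 := ih (by omega)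
        have hkN : (k : ℝ) ≤ (N : ℝ) + 1 := by exact_mod_cast (by omega : k ≤ N + 1)
        have i2 := h1 (((k + 1 : ℕ) : ℝ) * d) (k * d)
        have i3 := h2 (k * d) ⟨by positivity, by nlinarith⟩
        have i4 := mul_le_mul_of_nonneg_right i3 hd0.le
        push_cast at i2 ⊢
        nlinarith
    have := hk (N + 1) le_rfl
    push_cast at this
    rw [hdN] at this
    have e : M / 2 * (((N : ℝ) + 1) * ((N : ℝ) + 1 - 1)) * d ^ 2 = M / 2 - M / 2 * d := by
      have : M / 2 * (((N : ℝ) + 1) * ((N : ℝ) + 1 - 1)) * d ^ 2 =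
        M / 2 * ((((N : ℝ) + 1) * d) * (((N : ℝ) + 1) * d - d)) := by ring
      rw [this, hdN]; ring
    rw [e] at this
    linarith
  have hl : Tendsto (fun N : ℕ => Ef 0 + θ 0 + M / 2 - M / 2 * (1 / ((N : ℝ) + 1))) atTop
      (𝓝 (Ef 0 + θ 0 + M / 2 - M / 2 * 0)) :=
    tendsto_const_nhds.sub (tendsto_one_div_add_atTop_nhds_zero_nat.const_mul _)
  have := le_of_tendsto' hl hN
  linarith

theorem aux_dini (θ : ℝ → ℝ) (hθ : Continuous θ) (M : ℝ)
    (h : ∀ t, ∃ (τ : ℕ → ℝ) (L : ℝ), (∀ k, 0 < τ k) ∧ Tendsto τ atTop (𝓝 0) ∧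
      Tendsto (fun k => (τ k)⁻¹ * (θ (t + τ k) - θ t)) atTop (𝓝 L) ∧ M ≤ L) :
    ∀ t ∈ Icc (0 : ℝ) 1, θ 0 + M * t ≤ θ t := by
  have := image_le_of_liminf_slope_right_le_deriv_boundary (f := fun t => - θ t) (a := 0) (b := 1)
    (B := fun t => - θ 0 + (-M) * t) (B' := fun _ => -M) hθ.neg.continuousOn (by simp)
    (by fun_prop) (fun x _ => by
      simpa using (((hasDerivAt_id x).const_mul (-M)).const_add (-θ 0)).hasDerivWithinAt) ?_
  · intro t ht
    have h3 : - θ t ≤ - θ 0 + (-M) * t := this ht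
    linarith
  · intro t _ r hr
    obtain ⟨τ, L, hτ, hτ0, hL, hML⟩ := h t
    have h1 : Tendsto (fun k => t + τ k) atTop (𝓝[>] t) := by
      refine tendsto_nhdsWithin_iff.2 ⟨?_, Eventually.of_forall fun k => by simp [hτ k]⟩
      simpa using hτ0.const_add t
    have h2 : ∀ᶠ k in atTop, slope (fun t => - θ t) t (t + τ k) < r := by
      have : -L < r := by linarith
      filter_upwards [hL.neg.eventually_lt_const this] with k hk
      rw [slope_def_field]
      have e : t + τ k - t = τ k := by ring
      rw [e, div_eq_inv_mul]
      linarith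
    exact h1.frequently h2.frequently

variable {E : Type*} [NormedAddCommGroup E] [InnerProductSpace ℝ E]

theorem aux_nonexp (D : Set E) (F : E → ℝ) (lam : ℝ) (hl : 0 < lam) (P : E → E)
    (hP : ∀ p, P p ∈ D ∧ ∀ u ∈ D, F (P p) + ⟪lam⁻¹ • (p - P p), u - P p⟫ ≤ F u) (p q : E) :
    ‖P q - P p‖ ≤ ‖q - p‖ := by
  have h1 := (hP p).2 _ (hP q).1
  have h2 := (hP q).2 _ (hP p).1
  rw [inner_smul_left] at h1 h2
  simp only [conj_trivial] at h1 h2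
  have h3 : lam⁻¹ * (⟪p - P p, P q - P p⟫ + ⟪q - P q, P p - P q⟫) ≤ 0 := by linarith
  have h4 : ⟪p - P p, P q - P p⟫ + ⟪q - P q, P p - P q⟫ ≤ 0 := by
    by_contra hcon
    push Not at hcon
    have := mul_pos (inv_pos.2 hl) hcon
    linarith
  have h5 : ⟪p - P p, P q - P p⟫ + ⟪q - P q, P p - P q⟫ =
      ‖P q - P p‖ ^ 2 - ⟪q - p, P q - P p⟫ := by
    rw [← real_inner_self_eq_norm_sq]
    simp only [inner_sub_left, inner_sub_right]
    ring
  have h6 := real_inner_le_norm (q - p) (P q - P p)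
  by_contra hcon
  push Not at hcon
  have := norm_nonneg (q - p)
  nlinarith

theorem aux_core [FiniteDimensional ℝ E] (D : Set E) (F : E → ℝ) (lam : ℝ) (hl : 0 < lam)
    (P : E → E)
    (hP : ∀ p, P p ∈ D ∧ ∀ u ∈ D, F (P p) + ⟪lam⁻¹ • (p - P p), u - P p⟫ ≤ F u)
    (c : ℝ) (hc : 0 < c)
    (hT : ∀ (p d w : E) (τ : ℕ → ℝ), (∀ k, 0 < τ k) → Tendsto τ atTop (𝓝 0) →
      Tendsto (fun k => (τ k)⁻¹ • (P (p + τ k • d) - P p)) atTop (𝓝 w) →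
      c * ‖w‖ ^ 2 ≤ ⟪lam⁻¹ • (d - w), w⟫) (z x : E) (hx : x ∈ D) :
    F (P z) + ⟪lam⁻¹ • (z - P z), x - z⟫ + (c / (1 + lam * c)) / 2 * ‖x - z‖ ^ 2 ≤ F x := by
  set d := x - z with hd
  clear_value d
  set v : E → E := fun p => lam⁻¹ • (p - P p) with hv
  have hlv : ∀ p, lam • v p = p - P p := by
    intro p; simp only [hv]; rw [smul_inv_smul₀ hl.ne']
  set θ : ℝ → ℝ := fun t => ⟪v (z + t • d), d⟫ with hθ
  set Ef : ℝ → ℝ := fun t => F (P (z + t • d)) + lam / 2 * ‖v (z + t • d)‖ ^ 2 with hEf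
  have hne := aux_nonexp D F lam hl P hP
  have hPc : Continuous P := by
    refine LipschitzWith.continuous (K := 1) (LipschitzWith.of_dist_le_mul fun q p => ?_)
    rw [dist_eq_norm, dist_eq_norm]; simpa using hne p q
  have hθc : Continuous θ := by
    simp only [hθ, hv]; fun_prop
  have h1 : ∀ s t, Ef t + θ t * (s - t) ≤ Ef s := by
    intro s t
    have a1 := (hP (z + t • d)).2 _ (hP (z + s • d)).1
    have a2 : ⟪v (z + t • d), P (z + s • d) - P (z + t • d)⟫ =
        θ t * (s - t) - lam * (⟪v (z + t • d), v (z + s • d)⟫ - ‖v (z + t • d)‖ ^ 2) := by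
      have : P (z + s • d) - P (z + t • d) =
          (s - t) • d - lam • (v (z + s • d) - v (z + t • d)) := by
        rw [smul_sub, hlv, hlv]; module
      rw [this, inner_sub_right, inner_smul_right, inner_smul_right, inner_sub_right,
        real_inner_self_eq_norm_sq]
      simp only [hθ]; ring
    have a3 := norm_sub_sq_real (v (z + s • d)) (v (z + t • d))
    rw [real_inner_comm] at a3
    have a4 : 0 ≤ lam * ‖v (z + s • d) - v (z + t • d)‖ ^ 2 := by positivity
    rw [a3] at a4
    change F (P (z + t • d)) + ⟪v (z + t • d), P (z + s • d) - P (z + t • d)⟫ ≤ _ at a1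
    simp only [hEf]
    nlinarith
  have h2 := aux_dini θ hθc ((c / (1 + lam * c)) * ‖d‖ ^ 2) (by
    intro t
    set p := z + t • d with hp
    set τ : ℕ → ℝ := fun k => 1 / ((k : ℝ) + 1) with hτ
    have hτp : ∀ k, 0 < τ k := fun k => by simp only [hτ]; positivity
    have hτ0 : Tendsto τ atTop (𝓝 0) := tendsto_one_div_add_atTop_nhds_zero_nat
    have hbd : ∀ k, (τ k)⁻¹ • (P (p + τ k • d) - P p) ∈ Metric.closedBall (0 : E) ‖d‖ := by
      intro k
      rw [mem_closedBall_zero_iff, norm_smul, norm_inv, Real.norm_eq_abs, abs_of_pos (hτp k)]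
      have := hne p (p + τ k • d)
      rw [add_sub_cancel_left, norm_smul, Real.norm_eq_abs, abs_of_pos (hτp k)] at this
      rw [inv_mul_le_iff₀ (hτp k)]
      exact this
    obtain ⟨w, -, σ, hσ, hw⟩ := (isCompact_closedBall (0 : E) ‖d‖).tendsto_subseq hbd
    have hτσ : Tendsto (τ ∘ σ) atTop (𝓝 0) := hτ0.comp hσ.tendsto_atTop
    have hTw := hT p d w (τ ∘ σ) (fun k => hτp _) hτσ hw
    refine ⟨τ ∘ σ, ⟪lam⁻¹ • (d - w), d⟫, fun k => hτp _, hτσ, ?_, ?_⟩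
    · have : Tendsto (fun k => ⟪lam⁻¹ • (d - (τ (σ k))⁻¹ • (P (p + τ (σ k) • d) - P p)), d⟫) atTop
          (𝓝 ⟪lam⁻¹ • (d - w), d⟫) :=
        ((tendsto_const_nhds.sub hw).const_smul _).inner tendsto_const_nhds
      refine this.congr fun k => ?_
      have hne0 := (hτp (σ k)).ne'
      have e1 : z + (t + τ (σ k)) • d = p + τ (σ k) • d := by rw [hp]; module
      simp only [hθ, Function.comp, hv]
      rw [e1, ← hp, ← inner_sub_left, ← real_inner_smul_left]
      congr 1
      rw [← smul_sub, smul_comm]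
      congr 1
      have e2 : p + τ (σ k) • d - P (p + τ (σ k) • d) - (p - P p) =
        τ (σ k) • d - (P (p + τ (σ k) • d) - P p) := by abel
      rw [e2, smul_sub _ (τ (σ k) • d), inv_smul_smul₀ hne0]
    · set y := lam⁻¹ • (d - w) with hy
      have hdy : d = lam • y + w := by
        rw [hy, smul_inv_smul₀ hl.ne']; abel
      clear_value y
      have hpos : 0 < 1 + lam * c := by positivity
      rw [hdy, div_mul_eq_mul_div, div_le_iff₀ hpos, norm_add_sq_real, inner_add_right,
        inner_smul_right, inner_smul_left, norm_smul, mul_pow, Real.norm_eq_abs, sq_abs,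
        real_inner_self_eq_norm_sq]
      simp only [conj_trivial]
      have s1 : 0 ≤ ‖y - c • w‖ ^ 2 := by positivity
      rw [norm_sub_sq_real, inner_smul_right, norm_smul, mul_pow, Real.norm_eq_abs, sq_abs] at s1
      have s2 := mul_nonneg hl.le s1
      have s3 := mul_le_mul_of_nonneg_left hTw hpos.le
      nlinarith)
  have h3 := aux_riemann Ef θ _ h1 h2
  have h4 := (hP x).2 x hx
  have ex : z + (1 : ℝ) • d = x := by rw [hd]; module
  have ez : z + (0 : ℝ) • d = z := by module
  simp only [hEf, hθ, ex, ez] at h3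
  have h5 : ⟪v x, x - P x⟫ = lam * ‖v x‖ ^ 2 := by
    rw [← hlv, inner_smul_right, real_inner_self_eq_norm_sq]
  change F (P x) + ⟪v x, x - P x⟫ ≤ F x at h4
  rw [h5] at h4
  have h6 : 0 ≤ lam * ‖v x‖ ^ 2 := by positivity
  have h7 : 0 ≤ lam * ‖v z‖ ^ 2 := by positivity
  change F (P z) + ⟪v z, d⟫ + _ ≤ _
  linarith

theorem aux_lower (φ : EuclideanSpace ℝ (Fin n) → EReal) (hb : ∀ x, φ x ≠ ⊥)
    (hlsc : LowerSemicontinuous φ) (ρ : ℝ) (hρ : 0 ≤ ρ) (F : EuclideanSpace ℝ (Fin n) → ℝ)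
    (hF : F = fun x => (φ x).toReal + ρ / 2 * ‖x‖ ^ 2)
    (hc : ConvexOn ℝ {x | φ x ≠ ⊤} F) (z : EuclideanSpace ℝ (Fin n)) (hz : φ z ≠ ⊤) :
    ∃ B : ℝ, 0 ≤ B ∧ ∀ u, φ u ≠ ⊤ → F z - B - B * ‖u - z‖ ≤ F u := by
  obtain ⟨a, -, ha⟩ := (hlsc.lowerSemicontinuousOn (Metric.closedBall z 1)).exists_isMinOn
    ⟨z, by simp⟩ (isCompact_closedBall z 1)
  rw [isMinOn_iff] at ha
  have haz : φ a ≤ φ z := ha z (by simp)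
  have hat : φ a ≠ ⊤ := fun h => hz (top_le_iff.1 (h ▸ haz))
  have hm : ∀ u, φ u ≠ ⊤ → ‖u - z‖ ≤ 1 → (φ a).toReal ≤ F u := by
    intro u hu hur
    have h1 := EReal.toReal_le_toReal (ha u (by rwa [mem_closedBall_iff_norm])) (hb a) hu
    rw [hF]
    have : 0 ≤ ρ / 2 * ‖u‖ ^ 2 := by positivity
    simp only
    linarith
  have hzm := hm z hz (by simp)
  refine ⟨F z - (φ a).toReal, by linarith, fun u hu => ?_⟩
  rcases le_or_gt ‖u - z‖ 1 with hr | hr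
  · have h1 := hm u hu hr
    have h2 : 0 ≤ (F z - (φ a).toReal) * ‖u - z‖ := mul_nonneg (by linarith) (norm_nonneg _)
    linarith
  · set r := ‖u - z‖ with hrdef
    have hr0 : 0 < r := by linarith
    have ht1 : r⁻¹ ≤ 1 := inv_le_one_of_one_le₀ hr.le
    have ht0 : 0 ≤ r⁻¹ := by positivity
    have h1 := hc.1 hz hu (show 0 ≤ 1 - r⁻¹ by linarith) ht0 (by ring)
    have h2 := hc.2 hz hu (show 0 ≤ 1 - r⁻¹ by linarith) ht0 (by ring)
    have h3 := hm _ h1 (by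
      have : (1 - r⁻¹) • z + r⁻¹ • u - z = r⁻¹ • (u - z) := by module
      rw [this, norm_smul, ← hrdef, Real.norm_eq_abs, abs_of_nonneg ht0, inv_mul_cancel₀ hr0.ne'])
    have h4 := h3.trans h2
    simp only [smul_eq_mul] at h4
    have h5 := mul_le_mul_of_nonneg_left h4 hr0.le
    have h6 : r * ((1 - r⁻¹) * F z + r⁻¹ * F u) = r * F z - F z + F u := by
      field_simp
    rw [h6] at h5
    nlinarith

theorem aux_prox (φ : EuclideanSpace ℝ (Fin n) → EReal) (hb : ∀ x, φ x ≠ ⊥)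
    (hlsc : LowerSemicontinuous φ) (ρ : ℝ) (hρ : 0 ≤ ρ) (F : EuclideanSpace ℝ (Fin n) → ℝ)
    (hF : F = fun x => (φ x).toReal + ρ / 2 * ‖x‖ ^ 2)
    (hc : ConvexOn ℝ {x | φ x ≠ ⊤} F) (z : EuclideanSpace ℝ (Fin n)) (hz : φ z ≠ ⊤)
    (lam : ℝ) (hl : 0 < lam) (p : EuclideanSpace ℝ (Fin n)) :
    ∃ x, φ x ≠ ⊤ ∧ ∀ u, φ u ≠ ⊤ → F x + ⟪lam⁻¹ • (p - x), u - x⟫ ≤ F u := by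
  obtain ⟨B, hB, hBu⟩ := aux_lower φ hb hlsc ρ hρ F hF hc z hz
  set q : EuclideanSpace ℝ (Fin n) → ℝ := fun x => ρ / 2 * ‖x‖ ^ 2 + lam⁻¹ / 2 * ‖x - p‖ ^ 2 with hq
  have hqc : Continuous q := by simp only [hq]; fun_prop
  set G : EuclideanSpace ℝ (Fin n) → EReal := fun x => φ x + (q x : EReal) with hG
  have hGl : LowerSemicontinuous G := by
    refine hlsc.add' (continuous_coe_real_ereal.comp hqc).lowerSemicontinuous ?_
    intro x
    exact EReal.continuousAt_add (Or.inr (EReal.coe_ne_bot _)) (Or.inr (EReal.coe_ne_top _))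
  have hGr : ∀ x, φ x ≠ ⊤ → G x = ((F x + lam⁻¹ / 2 * ‖x - p‖ ^ 2 : ℝ) : EReal) := by
    intro x hx
    have : F x + lam⁻¹ / 2 * ‖x - p‖ ^ 2 = (φ x).toReal + q x := by
      simp only [hq, hF]; ring
    rw [this, EReal.coe_add, EReal.coe_toReal hx (hb x)]
  set s := ‖z - p‖ with hs
  have hs0 : 0 ≤ s := norm_nonneg _
  set R := 4 * lam * B + 2 * s + 1 with hR
  have hR0 : 0 ≤ R := by positivity
  obtain ⟨x, -, hx⟩ := (hGl.lowerSemicontinuousOn (Metric.closedBall z R)).exists_isMinOn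
    ⟨z, by simpa using hR0⟩ (isCompact_closedBall z R)
  rw [isMinOn_iff] at hx
  have hxz : G x ≤ G z := hx z (by simpa using hR0)
  have hxt : φ x ≠ ⊤ := by
    intro h
    rw [hGr z hz] at hxz
    simp only [hG, h, EReal.top_add_coe, top_le_iff] at hxz
    exact EReal.coe_ne_top _ hxz
  have hmin : ∀ u, φ u ≠ ⊤ →
      F x + lam⁻¹ / 2 * ‖x - p‖ ^ 2 ≤ F u + lam⁻¹ / 2 * ‖u - p‖ ^ 2 := by
    intro u hu
    rcases le_or_gt ‖u - z‖ R with hr | hr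
    · have := hx u (by rwa [mem_closedBall_iff_norm])
      rw [hGr x hxt, hGr u hu] at this
      exact_mod_cast this
    · rw [hGr x hxt, hGr z hz] at hxz
      have h1 : F x + lam⁻¹ / 2 * ‖x - p‖ ^ 2 ≤ F z + lam⁻¹ / 2 * s ^ 2 := by exact_mod_cast hxz
      have h2 := hBu u hu
      set r := ‖u - z‖ with hrd
      have h3 : r - s ≤ ‖u - p‖ := by
        have : ‖u - z‖ ≤ ‖u - p‖ + ‖z - p‖ := by
          have e : u - z = (u - p) - (z - p) := by abel
          rw [e]; exact norm_sub_le _ _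
        linarith
      have hlB : 0 ≤ lam * B := by positivity
      have h4 : (r - s) ^ 2 ≤ ‖u - p‖ ^ 2 := pow_le_pow_left₀ (by linarith) h3 2
      have h5 : 2 * lam * (B + B * r) ≤ (r - s) ^ 2 - s ^ 2 := by
        have hr1 : 1 ≤ r := by linarith
        nlinarith
      have h6 : B + B * r ≤ lam⁻¹ / 2 * ((r - s) ^ 2 - s ^ 2) := by
        have := mul_le_mul_of_nonneg_left h5 (show 0 ≤ lam⁻¹ / 2 by positivity)
        have e : lam⁻¹ / 2 * (2 * lam * (B + B * r)) = B + B * r := by field_simp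
        linarith
      have h7 := mul_le_mul_of_nonneg_left h4 (show 0 ≤ lam⁻¹ / 2 by positivity)
      linarith
  refine ⟨x, hxt, fun u hu => ?_⟩
  suffices F x + ⟪lam⁻¹ • (p - x), u - x⟫ - F u ≤ 0 by linarith
  refine aux_lim (B := lam⁻¹ / 2 * ‖u - x‖ ^ 2) ?_
  intro t ht0 ht1
  have h1 := hc.2 hxt hu (show 0 ≤ 1 - t by linarith) ht0.le (by ring)
  have h2 := hmin _ (hc.1 hxt hu (show 0 ≤ 1 - t by linarith) ht0.le (by ring))
  have e : (1 - t) • x + t • u - p = t • (u - x) - (p - x) := by module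
  have e' : ‖x - p‖ = ‖p - x‖ := norm_sub_rev _ _
  rw [e, norm_sub_sq_real (t • (u - x)), inner_smul_left, norm_smul, mul_pow, Real.norm_eq_abs, sq_abs,
    real_inner_comm (p - x), e'] at h2
  simp only [smul_eq_mul] at h1
  rw [inner_smul_left]
  simp only [conj_trivial] at h2 ⊢
  refine le_of_mul_le_mul_left ?_ ht0
  nlinarith

theorem aux_backward (φ : EuclideanSpace ℝ (Fin n) → EReal) (hb : ∀ x, φ x ≠ ⊥)
    (hlsc : LowerSemicontinuous φ) (ρ : ℝ) (hρ : 0 ≤ ρ) (F : EuclideanSpace ℝ (Fin n) → ℝ)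
    (hF : F = fun x => (φ x).toReal + ρ / 2 * ‖x‖ ^ 2)
    (hc : ConvexOn ℝ {x | φ x ≠ ⊤} F) (κ : ℝ) (hκ : 0 < κ)
    (hT : ∀ x y : EuclideanSpace ℝ (Fin n), (x, y) ∈ gphSubdiff ρ φ →
        ∀ w z : EuclideanSpace ℝ (Fin n),
          (w, z) ∈ contTangentCone (gphSubdiff ρ φ) (x, y) → κ * ‖w‖ ^ 2 ≤ ⟪z, w⟫)
    (z : EuclideanSpace ℝ (Fin n)) (hz : φ z ≠ ⊤) (lam : ℝ) (hl : 0 < lam) :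
    ∃ y, φ y ≠ ⊤ ∧ F y + lam⁻¹ * ‖y - z‖ ^ 2 ≤ F z ∧ ∃ v : EuclideanSpace ℝ (Fin n),
      ∀ x, φ x ≠ ⊤ →
        F y + ⟪v, x - z⟫ + ((κ + ρ) / (1 + lam * (κ + ρ))) / 2 * ‖x - z‖ ^ 2 ≤ F x := by
  choose P hP using aux_prox φ hb hlsc ρ hρ F hF hc z hz lam hl
  have hgr : ∀ p, (P p, lam⁻¹ • (p - P p) - ρ • P p) ∈ gphSubdiff ρ φ := by
    intro p
    rw [aux_mem_gph φ hb]
    refine ⟨(hP p).1, fun u hu => ?_⟩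
    have h1 := (hP p).2 u hu
    simp only [hF] at h1
    rw [inner_sub_left, real_inner_smul_left (P p)]
    have e : ‖u‖ ^ 2 = ‖P p‖ ^ 2 + 2 * ⟪P p, u - P p⟫ + ‖u - P p‖ ^ 2 := by
      rw [← norm_add_sq_real]; congr 2; abel
    rw [e] at h1
    linarith
  refine ⟨P z, (hP z).1, ?_, lam⁻¹ • (z - P z), fun x hx => ?_⟩
  · have := (hP z).2 z hz
    rw [real_inner_smul_left, real_inner_self_eq_norm_sq, norm_sub_rev] at this
    exact this
  refine aux_core {x | φ x ≠ ⊤} F lam hl P hP (κ + ρ) (by positivity) ?_ z x hx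
  intro p d w τ hτ hτ0 hw
  have := hT _ _ (hgr p) w (lam⁻¹ • (d - w) - ρ • w) ⟨τ, fun k =>
    ((τ k)⁻¹ • (P (p + τ k • d) - P p),
      lam⁻¹ • (d - (τ k)⁻¹ • (P (p + τ k • d) - P p)) - ρ • (τ k)⁻¹ • (P (p + τ k • d) - P p)),
    hτ, hτ0, ?_, ?_⟩
  · rw [inner_sub_left, real_inner_smul_left w, real_inner_self_eq_norm_sq] at this
    linarith
  · exact hw.prodMk_nhds (((tendsto_const_nhds.sub hw).const_smul _).sub (hw.const_smul _))
  · intro k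
    have hne := (hτ k).ne'
    have := hgr (p + τ k • d)
    convert this using 1
    have e : τ k • (τ k)⁻¹ • (P (p + τ k • d) - P p) = P (p + τ k • d) - P p :=
      smul_inv_smul₀ hne _
    ext1
    · simp only [Prod.fst_add, Prod.smul_fst]
      rw [e]; abel
    · simp only [Prod.snd_add, Prod.smul_snd]
      rw [smul_sub (τ k) (lam⁻¹ • _), smul_comm (τ k) lam⁻¹, smul_comm (τ k) ρ, smul_sub (τ k) d, e]
      module

theorem aux_final (φ : EuclideanSpace ℝ (Fin n) → EReal) (hb : ∀ x, φ x ≠ ⊥)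
    (hlsc : LowerSemicontinuous φ) (ρ : ℝ) (hρ : 0 ≤ ρ) (F : EuclideanSpace ℝ (Fin n) → ℝ)
    (hF : F = fun x => (φ x).toReal + ρ / 2 * ‖x‖ ^ 2)
    (hc : ConvexOn ℝ {x | φ x ≠ ⊤} F) (κ : ℝ) (hκ : 0 < κ)
    (hT : ∀ x y : EuclideanSpace ℝ (Fin n), (x, y) ∈ gphSubdiff ρ φ →
        ∀ w z : EuclideanSpace ℝ (Fin n),
          (w, z) ∈ contTangentCone (gphSubdiff ρ φ) (x, y) → κ * ‖w‖ ^ 2 ≤ ⟪z, w⟫) :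
    ConvexOn ℝ {x | φ x ≠ ⊤} (fun x => (φ x).toReal + (-κ) / 2 * ‖x‖ ^ 2) := by
  refine ⟨hc.1, ?_⟩
  intro x hx y hy a b ha hb' hab
  have hz := hc.1 hx hy ha hb' hab
  obtain rfl : a = 1 - b := by linarith
  have hquad := aux_quad x y b
  set z := (1 - b) • x + b • y with hzd
  have hzt : φ z ≠ ⊤ := hz
  set c := κ + ρ with hcd
  have hc0 : 0 < c := by positivity
  set l : ℕ → ℝ := fun k => 1 / ((k : ℝ) + 1) with hld
  have hl : ∀ k, 0 < l k := fun k => by simp only [hld]; positivity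
  have hl1 : ∀ k, l k ≤ 1 := fun k => by
    simp only [hld]
    rw [div_le_one (by positivity)]
    have : (0 : ℝ) ≤ k := by positivity
    linarith
  have hl0 : Tendsto l atTop (𝓝 0) := tendsto_one_div_add_atTop_nhds_zero_nat
  choose Y hYt hYz V hV using fun k =>
    aux_backward φ hb hlsc ρ hρ F hF hc κ hκ hT z hzt (l k) (hl k)
  obtain ⟨B, hB, hBu⟩ := aux_lower φ hb hlsc ρ hρ F hF hc z hzt
  have hY : Tendsto Y atTop (𝓝 z) := by
    rw [tendsto_iff_norm_sub_tendsto_zero]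
    have hsq : ∀ k, ‖Y k - z‖ ^ 2 ≤ l k * (B + B * (1 + 2 * B)) := by
      intro k
      have h1 := hBu (Y k) (hYt k)
      have h2 := hYz k
      have h3 : (l k)⁻¹ * ‖Y k - z‖ ^ 2 ≤ B + B * ‖Y k - z‖ := by linarith
      rw [inv_mul_le_iff₀ (hl k)] at h3
      set q := ‖Y k - z‖ with hq
      have hq0 : 0 ≤ q := norm_nonneg _
      have h4 : q ^ 2 ≤ B + B * q := by
        refine h3.trans ?_
        have : 0 ≤ B + B * q := by positivity
        nlinarith [hl1 k]
      have h5 : q ≤ 1 + 2 * B := by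
        by_contra hcon
        push Not at hcon
        nlinarith
      refine h3.trans (mul_le_mul_of_nonneg_left ?_ (hl k).le)
      nlinarith
    have h0 : Tendsto (fun k => ‖Y k - z‖ ^ 2) atTop (𝓝 0) := by
      refine squeeze_zero (fun k => by positivity) hsq ?_
      simpa using hl0.mul_const (B + B * (1 + 2 * B))
    have := h0.sqrt
    simpa [Real.sqrt_sq] using this
  have hin : ∀ k, F (Y k) + (c / (1 + l k * c)) / 2 * (b * (1 - b) * ‖y - x‖ ^ 2) ≤
      (1 - b) * F x + b * F y := by
    intro k
    have h1 := mul_le_mul_of_nonneg_left (hV k x hx) ha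
    have h2 := mul_le_mul_of_nonneg_left (hV k y hy) hb'
    have e1 : x - z = (-b) • (y - x) := by rw [hzd]; module
    have e2 : y - z = (1 - b) • (y - x) := by rw [hzd]; module
    rw [e1, real_inner_smul_right, norm_smul, mul_pow, Real.norm_eq_abs, sq_abs] at h1
    rw [e2, real_inner_smul_right, norm_smul, mul_pow, Real.norm_eq_abs, sq_abs] at h2
    linarith
  have hlim : ∀ r : ℝ, (r : EReal) < φ z →
      r + ρ / 2 * ‖z‖ ^ 2 + c / 2 * (b * (1 - b) * ‖y - x‖ ^ 2) ≤ (1 - b) * F x + b * F y := by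
    intro r hr
    have hev := hY.eventually (hlsc z _ hr)
    have ht : Tendsto (fun k => r + ρ / 2 * ‖Y k‖ ^ 2 +
        (c / (1 + l k * c)) / 2 * (b * (1 - b) * ‖y - x‖ ^ 2)) atTop
        (𝓝 (r + ρ / 2 * ‖z‖ ^ 2 + (c / (1 + 0 * c)) / 2 * (b * (1 - b) * ‖y - x‖ ^ 2))) := by
      refine (tendsto_const_nhds.add ((hY.norm.pow 2).const_mul _)).add (Tendsto.mul_const _ ?_)
      exact (tendsto_const_nhds.div (tendsto_const_nhds.add (hl0.mul_const c)) (by simp)).div_const 2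
    have e : c / (1 + 0 * c) = c := by simp
    rw [e] at ht
    refine le_of_tendsto ht ?_
    filter_upwards [hev] with k hk
    refine le_trans ?_ (hin k)
    have : r ≤ (φ (Y k)).toReal := by
      rw [← EReal.coe_le_coe_iff, EReal.coe_toReal (hYt k) (hb _)]
      exact hk.le
    simp only [hF]
    linarith
  have hfin : (φ z).toReal + ρ / 2 * ‖z‖ ^ 2 + c / 2 * (b * (1 - b) * ‖y - x‖ ^ 2) ≤
      (1 - b) * F x + b * F y := by
    refine le_of_forall_pos_le_add fun ε hε => ?_
    have := hlim ((φ z).toReal - ε) (by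
      conv_rhs => rw [← EReal.coe_toReal hzt (hb z)]
      rw [EReal.coe_lt_coe_iff]; linarith)
    linarith
  simp only [hF, smul_eq_mul] at hfin ⊢
  rw [hquad] at hfin ⊢
  rw [hcd] at hfin
  linarith

/-- a weakly convex function is strongly convex with modulus κ iff
tangent directions to the graph of its subdifferential satisfy ⟨z,w⟩ ≥ κ‖w‖². -/
theorem statement7 (n : ℕ) (φ : EuclideanSpace ℝ (Fin n) → EReal)
    (hnotbot : ∀ x, φ x ≠ ⊥) (hproper : ∃ x, φ x ≠ ⊤)
    (hlsc : LowerSemicontinuous φ)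
    (ρ : ℝ) (hρ : 0 ≤ ρ) (hweak : ERealConvex (shiftFun ρ φ)) (κ : ℝ) (hκ : 0 < κ) :
    ERealConvex (shiftFun (-κ) φ) ↔
      ∀ x y : EuclideanSpace ℝ (Fin n), (x, y) ∈ gphSubdiff ρ φ →
        ∀ w z : EuclideanSpace ℝ (Fin n),
          (w, z) ∈ contTangentCone (gphSubdiff ρ φ) (x, y) →
          κ * ‖w‖ ^ 2 ≤ ⟪z, w⟫ := by
  have hc := (aux_conv_iff φ hnotbot ρ).1 hweak
  rw [aux_conv_iff φ hnotbot]
  constructor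
  · intro h x y hxy w z hwz
    exact aux_forward' φ hnotbot ρ κ h x y hxy w z hwz
  · intro h
    exact aux_final φ hnotbot hlsc ρ hρ _ rfl hc κ hκ h

end
end

section
/- Let φ : ℝⁿ → ℝ ∪ {+∞} be proper, lower semicontinuous and ρ-weakly convex for some ρ ≥ 0. If d²φ(x,v)(w) ≥ 0 for every w ∈ ℝⁿ and every (x,v) ∈ gph ∂φ at which φ is twice epi-differentiable, then φ is convex. -/
open scoped RealInnerProductSpace
open Filter Topology MeasureTheory Set

noncomputable section

variable {n : ℕ}

/-- Local name for the ambient Euclidean space. -/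
abbrev EE (n : ℕ) := EuclideanSpace ℝ (Fin n)

structure ProxData (D : Set (EE n)) (F : EE n → ℝ) (ρ r : ℝ) (P : EE n → EE n) : Prop where
  hρ : 0 ≤ ρ
  hr : ρ < r
  mem : ∀ z, P z ∈ D
  sub : ∀ z, ∀ y ∈ D, F (P z) + r * ⟪z - P z, y - P z⟫ - ρ / 2 * ‖y - P z‖ ^ 2 ≤ F y

def env (F : EE n → ℝ) (r : ℝ) (P : EE n → EE n) (z : EE n) : ℝ :=
  F (P z) + r / 2 * ‖P z - z‖ ^ 2

variable {D : Set (EE n)} {F : EE n → ℝ} {ρ r : ℝ} {P : EE n → EE n}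

lemma ProxData.rpos (h : ProxData D F ρ r P) : 0 < r := lt_of_le_of_lt h.hρ h.hr

lemma ProxData.lip_aux (h : ProxData D F ρ r P) (z z' : EE n) :
    ‖P z - P z'‖ ≤ r / (r - ρ) * ‖z - z'‖ := by
  have h1 := h.sub z (P z') (h.mem z')
  have h2 := h.sub z' (P z) (h.mem z)
  have hr := h.hr
  have hpos : 0 < r - ρ := by linarith
  have e1 : ‖P z' - P z‖ = ‖P z - P z'‖ := norm_sub_rev _ _
  have e2 : ⟪z - P z, P z' - P z⟫ + ⟪z' - P z', P z - P z'⟫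
      = -⟪z - z', P z - P z'⟫ + ‖P z - P z'‖ ^ 2 := by
    rw [← real_inner_self_eq_norm_sq]
    simp only [inner_sub_left, inner_sub_right]
    ring
  rw [e1] at h1
  have h3 : (r - ρ) * ‖P z - P z'‖ ^ 2 ≤ r * ⟪z - z', P z - P z'⟫ := by
    have e3 : r * ⟪z - P z, P z' - P z⟫ + r * ⟪z' - P z', P z - P z'⟫
        = r * (-⟪z - z', P z - P z'⟫ + ‖P z - P z'‖ ^ 2) := by rw [← mul_add, e2]
    linarith
  have h4 := real_inner_le_norm (z - z') (P z - P z')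
  rcases eq_or_lt_of_le (norm_nonneg (P z - P z')) with h0 | h0
  · rw [← h0]
    have := h.rpos
    positivity
  · have h5 : (r - ρ) * ‖P z - P z'‖ ≤ r * ‖z - z'‖ := by
      have h6 : r * ⟪z - z', P z - P z'⟫ ≤ r * (‖z - z'‖ * ‖P z - P z'‖) :=
        mul_le_mul_of_nonneg_left h4 h.rpos.le
      by_contra hc
      push Not at hc
      nlinarith
    rw [div_mul_eq_mul_div, le_div_iff₀ hpos]
    linarith

lemma ProxData.lip (h : ProxData D F ρ r P) :
    LipschitzWith (Real.toNNReal (r / (r - ρ))) P := by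
  refine LipschitzWith.of_dist_le_mul fun z z' => ?_
  rw [dist_eq_norm, dist_eq_norm, Real.coe_toNNReal _ (div_nonneg h.rpos.le (by linarith [h.hr]))]
  exact h.lip_aux z z'

lemma ProxData.env_le (h : ProxData D F ρ r P) (z : EE n) {y : EE n} (hy : y ∈ D) :
    env F r P z ≤ F y + r / 2 * ‖y - z‖ ^ 2 := by
  have h1 := h.sub z y hy
  have e : ‖y - z‖ ^ 2 = ‖P z - z‖ ^ 2 - 2 * ⟪z - P z, y - P z⟫ + ‖y - P z‖ ^ 2 := by
    have : y - z = (y - P z) - (z - P z) := by abel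
    rw [this, norm_sub_sq_real, norm_sub_rev (P z) z, real_inner_comm]; ring
  unfold env
  rw [e]
  nlinarith [mul_nonneg (sub_nonneg.2 h.hr.le) (sq_nonneg ‖y - P z‖)]

lemma ProxData.env_upper (h : ProxData D F ρ r P) (z z' : EE n) :
    env F r P z' ≤ env F r P z + r * ⟪z - P z, z' - z⟫ + r / 2 * ‖z' - z‖ ^ 2 := by
  have h1 := h.env_le z' (h.mem z)
  have e : ‖P z - z'‖ ^ 2 = ‖P z - z‖ ^ 2 + 2 * ⟪z - P z, z' - z⟫ + ‖z' - z‖ ^ 2 := by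
    have : P z - z' = -((z - P z) + (z' - z)) := by abel
    rw [this, norm_neg, norm_add_sq_real, norm_sub_rev (P z) z]
  rw [e] at h1
  unfold env at *
  linarith

lemma ProxData.env_lower (h : ProxData D F ρ r P) (z z' : EE n) :
    env F r P z + r * ⟪z - P z, z' - z⟫ - (r * (r / (r - ρ))) * ‖z' - z‖ ^ 2
      ≤ env F r P z' := by
  have h1 := h.env_upper z' z
  have h2 := h.lip_aux z' z
  have h3 := real_inner_le_norm (P z' - P z) (z' - z)
  have e : ⟪z' - P z', z - z'⟫ = -⟪z - P z, z' - z⟫ - ‖z' - z‖ ^ 2 + ⟪P z' - P z, z' - z⟫ := by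
    rw [← real_inner_self_eq_norm_sq]
    simp only [inner_sub_left, inner_sub_right]
    ring
  rw [e, norm_sub_rev z z'] at h1
  have h4 : ⟪P z' - P z, z' - z⟫ ≤ r / (r - ρ) * ‖z' - z‖ ^ 2 := by
    nlinarith [norm_nonneg (z' - z)]
  have h5 := mul_le_mul_of_nonneg_left h4 h.rpos.le
  nlinarith [h.rpos, sq_nonneg ‖z' - z‖]

lemma ProxData.hasDerivAt (h : ProxData D F ρ r P) (z w : EE n) (t : ℝ) :
    HasDerivAt (fun s : ℝ => env F r P (z + s • w))
      (r * ⟪z + t • w - P (z + t • w), w⟫) t := by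
  rw [hasDerivAt_iff_isLittleO]
  set C := (r + r * (r / (r - ρ))) * ‖w‖ ^ 2 with hC
  have hrr : 0 ≤ r / (r - ρ) := div_nonneg h.rpos.le (by linarith [h.hr])
  have hO : (fun s : ℝ => env F r P (z + s • w) - env F r P (z + t • w)
      - (s - t) • (r * ⟪z + t • w - P (z + t • w), w⟫)) =O[𝓝 t] fun s => (s - t) ^ 2 := by
    refine Asymptotics.IsBigO.of_bound C (Eventually.of_forall fun s => ?_)
    have h1 := h.env_upper (z + t • w) (z + s • w)
    have h2 := h.env_lower (z + t • w) (z + s • w)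
    have e : z + s • w - (z + t • w) = (s - t) • w := by rw [sub_smul]; abel
    rw [e, norm_smul, inner_smul_right, mul_pow, Real.norm_eq_abs, sq_abs] at h1 h2
    rw [Real.norm_eq_abs, Real.norm_eq_abs, abs_of_nonneg (sq_nonneg (s - t)), abs_le, smul_eq_mul]
    have hp : 0 ≤ (s - t) ^ 2 * ‖w‖ ^ 2 := by positivity
    have hp2 := mul_nonneg (mul_nonneg h.rpos.le hrr) hp
    have hp3 := mul_nonneg h.rpos.le hp
    constructor <;> rw [hC] <;> nlinarith
  refine hO.trans_isLittleO ?_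
  have : (fun s : ℝ => (s - t) ^ 2) = fun s => (s - t) * (s - t) := by ext; ring
  rw [this]
  have h0 : (fun s : ℝ => s - t) =o[𝓝 t] fun _ => (1 : ℝ) := by
    rw [Asymptotics.isLittleO_one_iff]
    have : Tendsto (fun s : ℝ => s - t) (𝓝 t) (𝓝 (t - t)) := (continuous_id.sub continuous_const).tendsto t
    simpa using this
  simpa using h0.mul_isBigO (Asymptotics.isBigO_refl (fun s : ℝ => s - t) (𝓝 t))

/-- Second-order quotient of the envelope. -/
def Equot (F : EE n → ℝ) (r : ℝ) (P : EE n → EE n) (z w : EE n) (τ : ℝ) : ℝ :=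
  2 / τ ^ 2 * (env F r P (z + τ • w) - env F r P z - τ * (r * ⟪z - P z, w⟫))

lemma ProxData.tendsto_Equot (h : ProxData D F ρ r P) {z : EE n} {M : EE n →L[ℝ] EE n}
    (hM : HasFDerivAt P M z) (w : EE n) :
    Tendsto (Equot F r P z w) (𝓝[>] 0) (𝓝 (r * ⟪w - M w, w⟫)) := by
  have hline : HasDerivAt (fun s : ℝ => z + s • w) w 0 := by
    simpa using ((hasDerivAt_id (0:ℝ)).smul_const w).const_add z
  have hM' : HasFDerivAt P M (z + (0:ℝ) • w) := by simpa using hM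
  have hP : HasDerivAt (fun s : ℝ => P (z + s • w)) (M w) 0 := hM'.comp_hasDerivAt (0:ℝ) hline
  have hj : HasDerivAt (fun s : ℝ => r * ⟪z + s • w - P (z + s • w), w⟫)
      (r * ⟪w - M w, w⟫) 0 := by
    have := ((hline.sub hP).inner ℝ (hasDerivAt_const (0:ℝ) w)).const_mul r
    simpa using this
  have key : Tendsto (fun s : ℝ => (env F r P (z + s • w) - env F r P z - s * (r * ⟪z - P z, w⟫))
      / (s ^ 2 / 2)) (𝓝[>] 0) (𝓝 (r * ⟪w - M w, w⟫)) := by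
    refine HasDerivAt.lhopital_zero_nhdsGT
      (f' := fun s => r * ⟪z + s • w - P (z + s • w), w⟫ - r * ⟪z - P z, w⟫) (g' := fun s => s)
      (Eventually.of_forall fun s => ?_) (Eventually.of_forall fun s => ?_) ?_ ?_ ?_ ?_
    · have := ((h.hasDerivAt z w s).sub_const (env F r P z)).sub
        ((hasDerivAt_id s).mul_const (r * ⟪z - P z, w⟫))
      exact this.congr_deriv (by ring)
    · have := ((hasDerivAt_id s).pow 2).div_const 2
      exact this.congr_deriv (by simp)
    · filter_upwards [self_mem_nhdsWithin] with s hs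
      exact (ne_of_gt hs)
    · refine tendsto_nhdsWithin_of_tendsto_nhds ?_
      have hc : ContinuousAt (fun s : ℝ => env F r P (z + s • w) - env F r P z
        - s * (r * ⟪z - P z, w⟫)) 0 :=
        (((h.hasDerivAt z w 0).sub_const (env F r P z)).sub
          ((hasDerivAt_id (0:ℝ)).mul_const (r * ⟪z - P z, w⟫))).continuousAt
      simpa [ContinuousAt] using hc
    · refine tendsto_nhdsWithin_of_tendsto_nhds ?_
      have hc : Continuous (fun s : ℝ => s ^ 2 / 2) := by fun_prop
      simpa using hc.tendsto 0
    · have h3 := hj.tendsto_slope_zero_right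
      refine h3.congr' ?_
      filter_upwards with s
      simp [div_eq_inv_mul]
  refine key.congr fun s => ?_
  unfold Equot
  rw [div_eq_mul_inv, inv_div]; ring

lemma ae_line (w : EE n) {p : EE n → Prop} (hp : ∀ᵐ z : EE n, p z) :
    ∀ᵐ z : EE n, ∀ᵐ t : ℝ, p (z + t • w) := by
  set N := toMeasurable volume {z : EE n | ¬ p z} with hN
  have hNm : MeasurableSet N := measurableSet_toMeasurable _ _
  have hN0 : volume N = 0 := by rw [hN, measure_toMeasurable]; exact hp
  have hq : ∀ᵐ z : EE n, z ∉ N := by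
    rw [ae_iff]; simpa using hN0
  have hm : MeasurableSet {x : EE n × ℝ | x.1 + x.2 • w ∉ N} := by
    have hf : Measurable (fun x : EE n × ℝ => x.1 + x.2 • w) := by fun_prop
    exact hf hNm.compl
  have h2 : ∀ᵐ t : ℝ, ∀ᵐ z : EE n, z + t • w ∉ N := by
    refine Eventually.of_forall fun t => ?_
    exact (measurePreserving_add_right (volume : Measure (EE n)) (t • w)).quasiMeasurePreserving.ae hq
  have h3 := (Measure.ae_ae_comm (p := fun (z : EE n) (t : ℝ) => z + t • w ∉ N) hm).2 h2
  filter_upwards [h3] with z hz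
  filter_upwards [hz] with t ht
  by_contra hc
  exact ht (subset_toMeasurable _ _ hc)

lemma ProxData.mono (h : ProxData D F ρ r P)
    (hM : ∀ z (M : EE n →L[ℝ] EE n), HasFDerivAt P M z → ∀ w, 0 ≤ ⟪w - M w, M w⟫)
    (w z : EE n) :
    ⟪z - P z, w⟫ ≤ ⟪(z + w) - P (z + w), w⟫ := by
  have hae : ∀ᵐ z : EE n, DifferentiableAt ℝ P z := h.lip.ae_differentiableAt
  have hd : Dense {z : EE n | ∀ᵐ t : ℝ, DifferentiableAt ℝ P (z + t • w)} :=
    Measure.dense_of_ae (ae_line w hae)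
  have hPc : Continuous P := h.lip.continuous
  refine hd.induction (P := fun z => ⟪z - P z, w⟫ ≤ ⟪(z + w) - P (z + w), w⟫) ?_ ?_ z
  · intro z hz
    set j : ℝ → ℝ := fun s => ⟪z + s • w - P (z + s • w), w⟫ with hj
    have hl1 : LipschitzWith (‖w‖₊) (fun s : ℝ => z + s • w) := by
      refine LipschitzWith.of_dist_le_mul fun a b => ?_
      rw [dist_eq_norm, dist_eq_norm, add_sub_add_left_eq_sub, ← sub_smul, norm_smul, mul_comm]
      rfl
    have hl2 := h.lip.comp hl1
    have hl3 := hl1.sub hl2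
    have hl4 : LipschitzWith _ (fun y : EE n => ⟪w, y⟫) := (innerSL ℝ w).lipschitz
    have hl5 := hl4.comp hl3
    obtain ⟨K, hjl⟩ : ∃ K, LipschitzWith K j := by
      have : j = (fun y : EE n => ⟪w, y⟫) ∘ (fun s : ℝ => z + s • w - P (z + s • w)) := by
        ext s; simp [hj, real_inner_comm]
      rw [this]; exact ⟨_, hl5⟩
    have hac : AbsolutelyContinuousOnInterval j 0 1 :=
      (hjl.lipschitzOnWith (s := uIcc 0 1)).absolutelyContinuousOnInterval
    have hftc := hac.integral_deriv_eq_sub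
    have hnn : 0 ≤ ∫ x in (0:ℝ)..1, deriv j x := by
      refine intervalIntegral.integral_nonneg_of_ae zero_le_one ?_
      filter_upwards [hz] with t ht
      have hline : HasDerivAt (fun s : ℝ => z + s • w) w t := by
        simpa using ((hasDerivAt_id t).smul_const w).const_add z
      obtain ⟨M, hMt⟩ := ht
      have hP : HasDerivAt (fun s : ℝ => P (z + s • w)) (M w) t := hMt.comp_hasDerivAt t hline
      have hjd : HasDerivAt j (⟪w - M w, w⟫) t := by
        have := ((hline.sub hP).inner ℝ (hasDerivAt_const t w))
        simpa using this
      rw [hjd.deriv]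
      have h1 := hM _ M hMt w
      have e : ⟪w - M w, w⟫ = ⟪w - M w, M w⟫ + ‖w - M w‖ ^ 2 := by
        rw [← real_inner_self_eq_norm_sq, ← inner_add_right]; simp
      simp only [Pi.zero_apply]
      rw [e]; positivity
    rw [hftc] at hnn
    simp only [hj, zero_smul, add_zero, one_smul] at hnn
    linarith
  · exact isClosed_le (by fun_prop) (by fun_prop)

lemma ProxData.env_convex (h : ProxData D F ρ r P)
    (hM : ∀ z (M : EE n →L[ℝ] EE n), HasFDerivAt P M z → ∀ w, 0 ≤ ⟪w - M w, M w⟫)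
    (x y : EE n) {a b : ℝ} (ha : 0 ≤ a) (hb : 0 ≤ b) (hab : a + b = 1) :
    env F r P (a • x + b • y) ≤ a * env F r P x + b * env F r P y := by
  set k : ℝ → ℝ := fun s => env F r P (x + s • (y - x)) with hk
  have hd : ∀ t, HasDerivAt k _ t := fun t => h.hasDerivAt x (y - x) t
  have hc : ConvexOn ℝ univ k := by
    refine Monotone.convexOn_univ_of_deriv (fun t => (hd t).differentiableAt) ?_
    intro s t hst
    rw [(hd s).deriv, (hd t).deriv]
    refine mul_le_mul_of_nonneg_left ?_ h.rpos.le
    rcases eq_or_lt_of_le hst with rfl | hlt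
    · exact le_rfl
    have h1 := h.mono hM ((t - s) • (y - x)) (x + s • (y - x))
    have e : x + s • (y - x) + (t - s) • (y - x) = x + t • (y - x) := by
      rw [add_assoc, ← add_smul]; simp
    rw [e, inner_smul_right, inner_smul_right] at h1
    exact le_of_mul_le_mul_left h1 (by linarith)
  have := hc.2 (mem_univ 0) (mem_univ 1) ha hb hab
  simp only [hk, smul_eq_mul, mul_zero, mul_one, zero_add, zero_smul, add_zero, one_smul,
    add_sub_cancel] at this
  have e : a • x + b • y = x + b • (y - x) := by
    have : a = 1 - b := by linarith
    rw [this, sub_smul, smul_sub, one_smul]; abel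
  rw [e]; exact this

section ERealSide

variable {φ : EE n → EReal}

lemma coe_F (hnb : ∀ x, φ x ≠ ⊥) {y : EE n} (hy : φ y ≠ ⊤) : ((φ y).toReal : EReal) = φ y :=
  EReal.coe_toReal hy (hnb y)

lemma delta_of_mem (hnb : ∀ x, φ x ≠ ⊥) {x v u : EE n} {τ : ℝ} (hx : φ x ≠ ⊤)
    (hu : φ (x + τ • u) ≠ ⊤) :
    delta2 φ x v τ u
      = ((2 / τ ^ 2 * ((φ (x + τ • u)).toReal - (φ x).toReal - τ * ⟪v, u⟫) : ℝ) : EReal) := by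
  unfold delta2
  rw [← coe_F hnb hx, ← coe_F hnb hu]
  simp only [EReal.toReal_coe]
  norm_cast

lemma delta_top (hnb : ∀ x, φ x ≠ ⊥) {x v u : EE n} {τ : ℝ} (hτ : 0 < τ) (hx : φ x ≠ ⊤)
    (hu : φ (x + τ • u) = ⊤) : delta2 φ x v τ u = ⊤ := by
  unfold delta2
  rw [← coe_F hnb hx, hu, EReal.top_sub_coe, EReal.top_sub_coe]
  exact EReal.coe_mul_top_of_pos (by positivity)

variable {D : Set (EE n)} {F : EE n → ℝ} {ρ r : ℝ} {P : EE n → EE n}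

abbrev PD (φ : EE n → EReal) (ρ r : ℝ) (P : EE n → EE n) : Prop :=
  ProxData {y | φ y ≠ ⊤} (fun y => (φ y).toReal) ρ r P

lemma quad_id {r τ : ℝ} (hτ : 0 < τ) (a b : ℝ) (x z u w : EE n) :
    2 / τ ^ 2 * (b - a - τ * ⟪r • (z - x), u⟫)
    = 2 / τ ^ 2 * ((b + r / 2 * ‖x + τ • u - (z + τ • w)‖ ^ 2) - (a + r / 2 * ‖x - z‖ ^ 2)
        - τ * (r * ⟪z - x, w⟫)) - r * ‖u - w‖ ^ 2 := by
  have e : ‖x + τ • u - (z + τ • w)‖ ^ 2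
      = ‖x - z‖ ^ 2 - 2 * τ * (⟪z - x, u⟫ - ⟪z - x, w⟫) + τ ^ 2 * ‖u - w‖ ^ 2 := by
    have : x + τ • u - (z + τ • w) = τ • (u - w) - (z - x) := by rw [smul_sub]; abel
    rw [this, norm_sub_sq_real, norm_smul, inner_smul_left, inner_sub_left, norm_sub_rev z x,
      real_inner_comm u, real_inner_comm w, mul_pow, Real.norm_eq_abs, sq_abs]
    simp
    ring
  rw [e, inner_smul_left]
  simp only [conj_trivial]
  field_simp
  ring

lemma delta_ge (hnb : ∀ x, φ x ≠ ⊥) (h : PD φ ρ r P) (z w u : EE n) {τ : ℝ} (hτ : 0 < τ) :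
    ((Equot (fun y => (φ y).toReal) r P z w τ - r * ‖u - w‖ ^ 2 : ℝ) : EReal)
      ≤ delta2 φ (P z) (r • (z - P z)) τ u := by
  by_cases hu : φ (P z + τ • u) = ⊤
  · rw [delta_top hnb hτ (h.mem z) hu]; exact le_top
  · rw [delta_of_mem hnb (h.mem z) hu, EReal.coe_le_coe_iff, quad_id hτ _ _ _ _ _ w]
    have h1 := h.env_le (z + τ • w) hu
    unfold Equot
    have : env (fun y => (φ y).toReal) r P z = (φ (P z)).toReal + r / 2 * ‖P z - z‖ ^ 2 := rfl
    rw [← this]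
    gcongr

lemma delta_eq (hnb : ∀ x, φ x ≠ ⊥) (h : PD φ ρ r P) (z w : EE n) {τ : ℝ} (hτ : 0 < τ) :
    delta2 φ (P z) (r • (z - P z)) τ (τ⁻¹ • (P (z + τ • w) - P z))
     = ((Equot (fun y => (φ y).toReal) r P z w τ
        - r * ‖τ⁻¹ • (P (z + τ • w) - P z) - w‖ ^ 2 : ℝ) : EReal) := by
  have e : P z + τ • (τ⁻¹ • (P (z + τ • w) - P z)) = P (z + τ • w) := by
    rw [smul_inv_smul₀ hτ.ne']; abel
  have hu : φ (P z + τ • (τ⁻¹ • (P (z + τ • w) - P z))) ≠ ⊤ := by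
    rw [e]; exact h.mem _
  rw [delta_of_mem hnb (h.mem z) hu, quad_id hτ _ _ _ _ _ w, e]
  rfl

lemma ssd_ge (hnb : ∀ x, φ x ≠ ⊥) (h : PD φ ρ r P) {z : EE n} {M : EE n →L[ℝ] EE n}
    (hM : HasFDerivAt P M z) (w ξ : EE n) :
    ((r * ⟪w - M w, w⟫ - r * ‖ξ - w‖ ^ 2 : ℝ) : EReal)
      ≤ secondSubderiv φ (P z) (r • (z - P z)) ξ := by
  have hT : Tendsto (fun p : ℝ × EE n =>
      ((Equot (fun y => (φ y).toReal) r P z w p.1 - r * ‖p.2 - w‖ ^ 2 : ℝ) : EReal))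
      ((𝓝[>] (0 : ℝ)) ×ˢ 𝓝 ξ) (𝓝 ((r * ⟪w - M w, w⟫ - r * ‖ξ - w‖ ^ 2 : ℝ) : EReal)) := by
    refine (continuous_coe_real_ereal.tendsto _).comp ?_
    refine ((h.tendsto_Equot hM w).comp tendsto_fst).sub ?_
    have hc : Continuous (fun y : EE n => r * ‖y - w‖ ^ 2) := by fun_prop
    exact (hc.tendsto ξ).comp tendsto_snd
  unfold secondSubderiv
  rw [← hT.liminf_eq]
  refine liminf_le_liminf ?_
  have h0 : ∀ᶠ p : ℝ × EE n in (𝓝[>] (0 : ℝ)) ×ˢ 𝓝 ξ, 0 < p.1 :=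
    tendsto_fst.eventually (self_mem_nhdsWithin)
  filter_upwards [h0] with p hp
  exact delta_ge hnb h z w p.2 hp

lemma tendsto_u (P : EE n → EE n) {z : EE n} {M : EE n →L[ℝ] EE n}
    (hM : HasFDerivAt P M z) (w : EE n) :
    Tendsto (fun τ : ℝ => τ⁻¹ • (P (z + τ • w) - P z)) (𝓝[>] 0) (𝓝 (M w)) := by
  have hline : HasDerivAt (fun s : ℝ => z + s • w) w 0 := by
    simpa using ((hasDerivAt_id (0:ℝ)).smul_const w).const_add z
  have hM' : HasFDerivAt P M (z + (0:ℝ) • w) := by simpa using hM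
  have hP : HasDerivAt (fun s : ℝ => P (z + s • w)) (M w) 0 := hM'.comp_hasDerivAt (0:ℝ) hline
  simpa using hP.tendsto_slope_zero_right

lemma tendsto_delta (hnb : ∀ x, φ x ≠ ⊥) (h : PD φ ρ r P) {z : EE n} {M : EE n →L[ℝ] EE n}
    (hM : HasFDerivAt P M z) (w : EE n) :
    Tendsto (fun τ : ℝ => delta2 φ (P z) (r • (z - P z)) τ (τ⁻¹ • (P (z + τ • w) - P z)))
      (𝓝[>] 0) (𝓝 ((r * ⟪w - M w, w⟫ - r * ‖M w - w‖ ^ 2 : ℝ) : EReal)) := by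
  have hT : Tendsto (fun τ : ℝ => ((Equot (fun y => (φ y).toReal) r P z w τ
        - r * ‖τ⁻¹ • (P (z + τ • w) - P z) - w‖ ^ 2 : ℝ) : EReal))
      (𝓝[>] (0 : ℝ)) (𝓝 ((r * ⟪w - M w, w⟫ - r * ‖M w - w‖ ^ 2 : ℝ) : EReal)) := by
    refine (continuous_coe_real_ereal.tendsto _).comp ?_
    refine (h.tendsto_Equot hM w).sub ?_
    have hc : Continuous (fun y : EE n => r * ‖y - w‖ ^ 2) := by fun_prop
    exact (hc.tendsto (M w)).comp (tendsto_u P hM w)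
  refine hT.congr' ?_
  filter_upwards [self_mem_nhdsWithin] with τ hτ
  exact (delta_eq hnb h z w hτ).symm

lemma ssd_eq (hnb : ∀ x, φ x ≠ ⊥) (h : PD φ ρ r P) {z : EE n} {M : EE n →L[ℝ] EE n}
    (hM : HasFDerivAt P M z) (w : EE n) :
    secondSubderiv φ (P z) (r • (z - P z)) (M w)
      = ((r * ⟪w - M w, w⟫ - r * ‖M w - w‖ ^ 2 : ℝ) : EReal) := by
  refine le_antisymm ?_ (ssd_ge hnb h hM w (M w))
  rw [← (tendsto_delta hnb h hM w).liminf_eq]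
  have hpair : Tendsto (fun τ : ℝ => (τ, τ⁻¹ • (P (z + τ • w) - P z))) (𝓝[>] 0)
      ((𝓝[>] (0 : ℝ)) ×ˢ 𝓝 (M w)) := tendsto_id.prodMk (tendsto_u P hM w)
  have := liminf_le_liminf_of_le (u := fun p : ℝ × EE n =>
    delta2 φ (P z) (r • (z - P z)) p.1 p.2) hpair
  rw [← liminf_comp] at this
  exact this

lemma ssd_top (hnb : ∀ x, φ x ≠ ⊥) (h : PD φ ρ r P) {z : EE n} {M : EE n →L[ℝ] EE n}
    (hM : HasFDerivAt P M z) {ξ : EE n} (hξ : ξ ∉ M.toLinearMap.range) :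
    secondSubderiv φ (P z) (r • (z - P z)) ξ = ⊤ := by
  obtain ⟨k, hk, hkξ⟩ : ∃ k ∈ (M.toLinearMap.range)ᗮ, ⟪k, ξ⟫ ≠ 0 := by
    by_contra hc
    push Not at hc
    apply hξ
    rw [← Submodule.orthogonal_orthogonal (M.toLinearMap.range), Submodule.mem_orthogonal]
    exact hc
  rw [EReal.eq_top_iff_forall_lt]
  intro c
  have hr := h.rpos
  set t : ℝ := ((c + 1) / r + ‖ξ‖ ^ 2) / (2 * ⟪k, ξ⟫) with ht
  refine lt_of_lt_of_le ?_ (ssd_ge hnb h hM (t • k) ξ)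
  rw [EReal.coe_lt_coe_iff]
  have h0 : ⟪M k, k⟫ = 0 := 
    Submodule.inner_right_of_mem_orthogonal (K := M.toLinearMap.range)
      (LinearMap.mem_range_self M.toLinearMap k) hk
  have e1 : ⟪t • k - M (t • k), t • k⟫ = t ^ 2 * ‖k‖ ^ 2 := by
    rw [map_smul, ← smul_sub, inner_smul_left, inner_smul_right, inner_sub_left, h0,
      real_inner_self_eq_norm_sq]
    simp; ring
  have e2 : ‖ξ - t • k‖ ^ 2 = ‖ξ‖ ^ 2 - 2 * (t * ⟪k, ξ⟫) + t ^ 2 * ‖k‖ ^ 2 := by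
    rw [norm_sub_sq_real, inner_smul_right, norm_smul, mul_pow, Real.norm_eq_abs, sq_abs,
      real_inner_comm]
  have e3 : 2 * (t * ⟪k, ξ⟫) = (c + 1) / r + ‖ξ‖ ^ 2 := by
    rw [ht]; field_simp
  rw [e1, e2, e3]
  have : r * (t ^ 2 * ‖k‖ ^ 2) - r * (‖ξ‖ ^ 2 - ((c + 1) / r + ‖ξ‖ ^ 2) + t ^ 2 * ‖k‖ ^ 2)
    = c + 1 := by field_simp; ring
  linarith

lemma twiceEpi (hnb : ∀ x, φ x ≠ ⊥) (h : PD φ ρ r P) {z : EE n} {M : EE n →L[ℝ] EE n}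
    (hM : HasFDerivAt P M z) : TwiceEpiDiff φ (P z) (r • (z - P z)) := by
  intro ξ τ hτ hτ0
  have hτ' : Tendsto τ atTop (𝓝[>] 0) :=
    tendsto_nhdsWithin_iff.2 ⟨hτ0, Eventually.of_forall hτ⟩
  by_cases hξ : ξ ∈ M.toLinearMap.range
  · obtain ⟨w, rfl⟩ := hξ
    refine ⟨fun k => (τ k)⁻¹ • (P (z + τ k • w) - P z), (tendsto_u P hM w).comp hτ', ?_⟩
    have := (tendsto_delta hnb h hM w).comp hτ'
    rw [← ssd_eq hnb h hM w] at this
    exact this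
  · refine ⟨fun _ => ξ, tendsto_const_nhds, ?_⟩
    have htop := ssd_top hnb h hM hξ
    rw [htop, EReal.tendsto_nhds_top_iff_real]
    intro c
    have hlt : (c : EReal) < secondSubderiv φ (P z) (r • (z - P z)) ξ := by
      rw [htop]; exact EReal.coe_lt_top c
    have hev := eventually_lt_of_lt_liminf hlt
    have hpair : Tendsto (fun k => (τ k, ξ)) atTop ((𝓝[>] (0 : ℝ)) ×ˢ 𝓝 ξ) :=
      hτ'.prodMk tendsto_const_nhds
    exact hpair.eventually hev

lemma psd (hnb : ∀ x, φ x ≠ ⊥) (h : PD φ ρ r P)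
    (hyp : ∀ x v : EE n, (x, v) ∈ gphSubdiff ρ φ →
      TwiceEpiDiff φ x v → ∀ w : EE n, 0 ≤ secondSubderiv φ x v w)
    (z : EE n) (M : EE n →L[ℝ] EE n) (hM : HasFDerivAt P M z) (w : EE n) :
    0 ≤ ⟪w - M w, M w⟫ := by
  have hg : (P z, r • (z - P z)) ∈ gphSubdiff ρ φ := by
    refine ⟨h.mem z, fun u => ?_⟩
    by_cases hu : φ u = ⊤
    · rw [hu]; exact le_top
    · have := h.sub z u hu
      rw [← coe_F hnb hu, ← coe_F hnb (h.mem z), ← EReal.coe_add, EReal.coe_le_coe_iff]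
      rw [inner_smul_left]
      simp only [conj_trivial]
      linarith
  have h1 := hyp _ _ hg (twiceEpi hnb h hM) (M w)
  rw [ssd_eq hnb h hM w, ← EReal.coe_zero, EReal.coe_le_coe_iff] at h1
  have e : r * ⟪w - M w, w⟫ - r * ‖M w - w‖ ^ 2 = r * ⟪w - M w, M w⟫ := by
    rw [norm_sub_rev, ← real_inner_self_eq_norm_sq, ← mul_sub, ← inner_sub_right]; simp
  rw [e] at h1
  exact nonneg_of_mul_nonneg_right h1 h.rpos

end ERealSide

section Existence

variable {φ : EE n → EReal} {ρ : ℝ}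

lemma real_conv (hnb : ∀ x, φ x ≠ ⊥) (hweak : ERealConvex (shiftFun ρ φ)) {x y : EE n}
    (hx : φ x ≠ ⊤) (hy : φ y ≠ ⊤) {a b : ℝ} (ha : 0 ≤ a) (hb : 0 ≤ b) (hab : a + b = 1) :
    φ (a • x + b • y) ≠ ⊤ ∧
      (φ (a • x + b • y)).toReal + ρ / 2 * ‖a • x + b • y‖ ^ 2
        ≤ a * ((φ x).toReal + ρ / 2 * ‖x‖ ^ 2) + b * ((φ y).toReal + ρ / 2 * ‖y‖ ^ 2) := by
  have h := hweak x y a b ha hb hab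
  unfold shiftFun at h
  rw [← coe_F hnb hx, ← coe_F hnb hy] at h
  have hne : φ (a • x + b • y) ≠ ⊤ := by
    intro ht
    rw [ht, EReal.top_add_coe] at h
    norm_cast at h
  refine ⟨hne, ?_⟩
  rw [← coe_F hnb hne] at h
  exact_mod_cast h

lemma lower_bound (hnb : ∀ x, φ x ≠ ⊥) (hproper : ∃ x, φ x ≠ ⊤) (hlsc : LowerSemicontinuous φ)
    (hρ : 0 ≤ ρ) (hweak : ERealConvex (shiftFun ρ φ)) :
    ∃ A K : ℝ, 0 ≤ A ∧ 0 ≤ K ∧ ∀ y, φ y ≠ ⊤ → -A - K * ‖y‖ ^ 2 ≤ (φ y).toReal := by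
  obtain ⟨x₀, hx₀⟩ := hproper
  obtain ⟨m₀, hm₀, hmin⟩ := LowerSemicontinuousOn.exists_isMinOn
    (s := Metric.closedBall x₀ 1) ⟨x₀, by simp⟩ (isCompact_closedBall x₀ 1)
    (hlsc.lowerSemicontinuousOn _)
  have hm_top : φ m₀ ≠ ⊤ := by
    have : φ m₀ ≤ φ x₀ := hmin (by simp)
    exact ne_top_of_le_ne_top hx₀ this
  set m := (φ m₀).toReal with hm
  have hball : ∀ y, φ y ≠ ⊤ → ‖y - x₀‖ ≤ 1 → m ≤ (φ y).toReal := by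
    intro y hy hyb
    exact EReal.toReal_le_toReal (hmin (by simpa [dist_eq_norm] using hyb)) (hnb _) hy
  set g := (φ x₀).toReal + ρ / 2 * ‖x₀‖ ^ 2 with hg
  set C := |m| + |g| with hC
  have hC0 : 0 ≤ C := by positivity
  have main : ∀ y, φ y ≠ ⊤ →
      -(2 * C * (1 + ‖y - x₀‖)) ≤ (φ y).toReal + ρ / 2 * ‖y‖ ^ 2 := by
    intro y hy
    have hn := norm_nonneg (y - x₀)
    have hmC : -C ≤ m := by
      have := neg_abs_le m; have := abs_nonneg g; linarith
    have hgC : g ≤ C := by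
      have := le_abs_self g; have := abs_nonneg m; linarith
    rcases le_or_gt ‖y - x₀‖ 1 with h1 | h1
    · have := hball y hy h1
      have h2 : 0 ≤ ρ / 2 * ‖y‖ ^ 2 := by positivity
      nlinarith
    · set R := ‖y - x₀‖ with hR
      have hR0 : 0 < R := by linarith
      have hb : 0 ≤ 1 / R := by positivity
      have hb1 : 1 / R ≤ 1 := by rw [div_le_one hR0]; exact h1.le
      obtain ⟨hne, hle⟩ := real_conv hnb hweak hx₀ hy (a := 1 - 1 / R) (b := 1 / R)
        (by linarith) hb (by ring)
      have hp : ‖((1 - 1 / R) • x₀ + (1 / R) • y) - x₀‖ ≤ 1 := by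
        have : ((1 - 1 / R) • x₀ + (1 / R) • y) - x₀ = (1 / R) • (y - x₀) := by
          rw [sub_smul, smul_sub, one_smul]; abel
        rw [this, norm_smul, Real.norm_eq_abs, abs_of_nonneg hb, ← hR]
        rw [one_div_mul_cancel hR0.ne']
      have h3 := hball _ hne hp
      have h4 : 0 ≤ ρ / 2 * ‖(1 - 1 / R) • x₀ + (1 / R) • y‖ ^ 2 := by positivity
      have h5 : m ≤ (1 - 1 / R) * g + 1 / R * ((φ y).toReal + ρ / 2 * ‖y‖ ^ 2) := by
        rw [← hg] at hle; linarith
      have h6 : R * m ≤ (R - 1) * g + ((φ y).toReal + ρ / 2 * ‖y‖ ^ 2) := by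
        have := mul_le_mul_of_nonneg_left h5 hR0.le
        have e : R * ((1 - 1 / R) * g + 1 / R * ((φ y).toReal + ρ / 2 * ‖y‖ ^ 2))
          = (R - 1) * g + ((φ y).toReal + ρ / 2 * ‖y‖ ^ 2) := by field_simp
        linarith
      have h7 : -(C * R) ≤ R * m := by nlinarith
      have h8 : (R - 1) * g ≤ (R - 1) * C := mul_le_mul_of_nonneg_left hgC (by linarith)
      nlinarith
  refine ⟨2 * C * (2 + ‖x₀‖), 2 * C + ρ / 2, by positivity, by positivity, fun y hy => ?_⟩
  have h1 := main y hy
  have h2 : ‖y - x₀‖ ≤ 1 + ‖y‖ ^ 2 + ‖x₀‖ := by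
    have := norm_sub_le y x₀
    nlinarith [sq_nonneg (‖y‖ - 1), norm_nonneg y]
  have h3 : 2 * C * ‖y - x₀‖ ≤ 2 * C * (1 + ‖y‖ ^ 2 + ‖x₀‖) :=
    mul_le_mul_of_nonneg_left h2 (by positivity)
  nlinarith

lemma norm_sq_le_two (a b : EE n) : ‖a‖ ^ 2 ≤ 2 * ‖a - b‖ ^ 2 + 2 * ‖b‖ ^ 2 := by
  have h : ‖a‖ ≤ ‖a - b‖ + ‖b‖ := by simpa using norm_add_le (a - b) b
  nlinarith [norm_nonneg a, sq_nonneg (‖a - b‖ - ‖b‖)]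

lemma exists_min (hnb : ∀ x, φ x ≠ ⊥) (hproper : ∃ x, φ x ≠ ⊤) (hlsc : LowerSemicontinuous φ)
    {A K r : ℝ} (hr0 : 0 < r) (hr : 4 * K < r)
    (hlb : ∀ y, φ y ≠ ⊤ → -A - K * ‖y‖ ^ 2 ≤ (φ y).toReal) (z : EE n) :
    ∃ x, φ x ≠ ⊤ ∧ ∀ y, φ y ≠ ⊤ →
      (φ x).toReal + r / 2 * ‖x - z‖ ^ 2 ≤ (φ y).toReal + r / 2 * ‖y - z‖ ^ 2 := by
  obtain ⟨x₀, hx₀⟩ := hproper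
  set c := (φ x₀).toReal + r / 2 * ‖x₀ - z‖ ^ 2 with hc
  set Q := c + A + r / 2 * ‖z‖ ^ 2 with hQ
  set d := r / 4 - K with hd
  have hd0 : 0 < d := by linarith
  set S := ‖x₀‖ + 1 + |Q| / d with hS
  have hQd : 0 ≤ |Q| / d := by positivity
  have hS1 : 1 ≤ S := by have := norm_nonneg x₀; linarith
  have hSQ : Q ≤ d * S ^ 2 := by
    have h1 : |Q| / d ≤ S := by have := norm_nonneg x₀; linarith
    rw [div_le_iff₀ hd0] at h1
    have h2 : S ≤ S ^ 2 := by nlinarith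
    have h3 := mul_le_mul_of_nonneg_left h2 hd0.le
    have := le_abs_self Q
    linarith
  have hout : ∀ y, φ y ≠ ⊤ → S < ‖y‖ → c ≤ (φ y).toReal + r / 2 * ‖y - z‖ ^ 2 := by
    intro y hy hyS
    have h1 := hlb y hy
    have h2 := norm_sq_le_two y z
    have h3 : S ^ 2 ≤ ‖y‖ ^ 2 := by nlinarith
    have h4 := mul_le_mul_of_nonneg_left h3 hd0.le
    have h5 := mul_le_mul_of_nonneg_left h2 hr0.le
    have h6 : d * ‖y‖ ^ 2 = r / 4 * ‖y‖ ^ 2 - K * ‖y‖ ^ 2 := by rw [hd]; ring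
    linarith
  have hf : LowerSemicontinuous (fun y => φ y + ((r / 2 * ‖y - z‖ ^ 2 : ℝ) : EReal)) := by
    refine LowerSemicontinuous.add' hlsc ?_ ?_
    · refine Continuous.lowerSemicontinuous ?_
      exact continuous_coe_real_ereal.comp (by fun_prop)
    · intro x
      exact EReal.continuousAt_add (Or.inr (EReal.coe_ne_bot _)) (Or.inr (EReal.coe_ne_top _))
  have hx₀S : x₀ ∈ Metric.closedBall (0 : EE n) S := by
    simp only [Metric.mem_closedBall, dist_zero_right]; linarith
  obtain ⟨x, hxS, hmin⟩ := LowerSemicontinuousOn.exists_isMinOn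
    (s := Metric.closedBall (0 : EE n) S) ⟨x₀, hx₀S⟩ (isCompact_closedBall 0 S)
    (hf.lowerSemicontinuousOn _)
  have hxt : φ x ≠ ⊤ := by
    intro ht
    have h1 : φ x + ((r / 2 * ‖x - z‖ ^ 2 : ℝ) : EReal)
      ≤ φ x₀ + ((r / 2 * ‖x₀ - z‖ ^ 2 : ℝ) : EReal) := hmin hx₀S
    rw [ht, EReal.top_add_coe, ← coe_F hnb hx₀, ← EReal.coe_add] at h1
    exact EReal.coe_ne_top _ (top_le_iff.1 h1)
  have hin : ∀ y, φ y ≠ ⊤ → y ∈ Metric.closedBall (0 : EE n) S →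
      (φ x).toReal + r / 2 * ‖x - z‖ ^ 2 ≤ (φ y).toReal + r / 2 * ‖y - z‖ ^ 2 := by
    intro y hy hyS
    have h1 : φ x + ((r / 2 * ‖x - z‖ ^ 2 : ℝ) : EReal)
      ≤ φ y + ((r / 2 * ‖y - z‖ ^ 2 : ℝ) : EReal) := hmin hyS
    rw [← coe_F hnb hxt, ← coe_F hnb hy] at h1
    exact_mod_cast h1
  refine ⟨x, hxt, fun y hy => ?_⟩
  by_cases hyS : y ∈ Metric.closedBall (0 : EE n) S
  · exact hin y hy hyS
  · refine (hin x₀ hx₀ hx₀S).trans (hout y hy ?_)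
    simpa using hyS

lemma min_sub (hnb : ∀ x, φ x ≠ ⊥) (hweak : ERealConvex (shiftFun ρ φ)) {r : ℝ} {x z : EE n}
    (hx : φ x ≠ ⊤) (hmin : ∀ y, φ y ≠ ⊤ →
      (φ x).toReal + r / 2 * ‖x - z‖ ^ 2 ≤ (φ y).toReal + r / 2 * ‖y - z‖ ^ 2)
    (y : EE n) (hy : φ y ≠ ⊤) :
    (φ x).toReal + r * ⟪z - x, y - x⟫ - ρ / 2 * ‖y - x‖ ^ 2 ≤ (φ y).toReal := by
  have key : ∀ t : ℝ, 0 < t → t < 1 →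
      (φ x).toReal + r * ⟪z - x, y - x⟫
        - ρ / 2 * (1 - t) * ‖y - x‖ ^ 2 - r / 2 * t * ‖y - x‖ ^ 2 ≤ (φ y).toReal := by
    intro t ht0 ht1
    obtain ⟨hne, hle⟩ := real_conv hnb hweak hx hy (a := 1 - t) (b := t)
      (by linarith) ht0.le (by ring)
    have hm := hmin _ hne
    have e0 : (1 - t) • x + t • y = x + t • (y - x) := by
      rw [sub_smul, smul_sub, one_smul]; abel
    rw [e0] at hle hm
    have e1 : ‖x + t • (y - x) - z‖ ^ 2
        = ‖x - z‖ ^ 2 - 2 * t * ⟪z - x, y - x⟫ + t ^ 2 * ‖y - x‖ ^ 2 := by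
      have : x + t • (y - x) - z = t • (y - x) - (z - x) := by abel
      rw [this, norm_sub_sq_real, inner_smul_left, norm_smul, mul_pow, Real.norm_eq_abs, sq_abs,
        norm_sub_rev z x, real_inner_comm]
      simp; ring
    have e2 : ‖x + t • (y - x)‖ ^ 2
        = (1 - t) * ‖x‖ ^ 2 + t * ‖y‖ ^ 2 - t * (1 - t) * ‖y - x‖ ^ 2 := by
      rw [norm_add_sq_real, inner_smul_right, norm_smul, mul_pow, Real.norm_eq_abs, sq_abs,
        norm_sub_sq_real, inner_sub_right, real_inner_self_eq_norm_sq, real_inner_comm]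
      ring
    rw [e1] at hm
    rw [e2] at hle
    refine le_of_mul_le_mul_left ?_ ht0
    linarith
  have hlim : Tendsto (fun t : ℝ => (φ x).toReal + r * ⟪z - x, y - x⟫
        - ρ / 2 * (1 - t) * ‖y - x‖ ^ 2 - r / 2 * t * ‖y - x‖ ^ 2) (𝓝[>] 0)
        (𝓝 ((φ x).toReal + r * ⟪z - x, y - x⟫ - ρ / 2 * ‖y - x‖ ^ 2)) := by
    refine tendsto_nhdsWithin_of_tendsto_nhds ?_
    have hc : Continuous (fun t : ℝ => (φ x).toReal + r * ⟪z - x, y - x⟫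
        - ρ / 2 * (1 - t) * ‖y - x‖ ^ 2 - r / 2 * t * ‖y - x‖ ^ 2) := by fun_prop
    simpa using hc.tendsto 0
  refine le_of_tendsto hlim ?_
  have : ∀ᶠ t : ℝ in 𝓝[>] 0, t < 1 :=
    nhdsWithin_le_nhds (eventually_lt_nhds zero_lt_one)
  filter_upwards [self_mem_nhdsWithin, this] with t h0 h1
  exact key t h0 h1

lemma exists_PD (hnb : ∀ x, φ x ≠ ⊥) (hproper : ∃ x, φ x ≠ ⊤) (hlsc : LowerSemicontinuous φ)
    (hρ : 0 ≤ ρ) (hweak : ERealConvex (shiftFun ρ φ))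
    {A K r : ℝ} (hr0 : ρ < r) (hr : 4 * K < r)
    (hlb : ∀ y, φ y ≠ ⊤ → -A - K * ‖y‖ ^ 2 ≤ (φ y).toReal) : ∃ P : EE n → EE n, PD φ ρ r P := by
  choose P hP hmin using
    exists_min hnb hproper hlsc (lt_of_le_of_lt hρ hr0) hr hlb
  exact ⟨P, hρ, hr0, hP, fun z y hy => min_sub hnb hweak (hP z) (hmin z) y hy⟩

lemma env_approx (hnb : ∀ x, φ x ≠ ⊥) (hlsc : LowerSemicontinuous φ)
    {A K : ℝ} (hK : 0 ≤ K) (hlb : ∀ y, φ y ≠ ⊤ → -A - K * ‖y‖ ^ 2 ≤ (φ y).toReal)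
    (u : EE n) {c : ℝ} (hc : (c : EReal) < φ u) :
    ∃ R : ℝ, ∀ r, R ≤ r → ∀ P : EE n → EE n, PD φ ρ r P →
      c ≤ env (fun y => (φ y).toReal) r P u := by
  obtain ⟨δ, hδ, hb⟩ := Metric.eventually_nhds_iff.1 (hlsc u c hc)
  set Q := c + A + 2 * K * ‖u‖ ^ 2 with hQ
  refine ⟨4 * K + 2 * |Q| / δ ^ 2, fun r hr P h => ?_⟩
  have hx := h.mem u
  unfold env
  have hrp := h.rpos
  rcases lt_or_ge ‖P u - u‖ δ with h1 | h1
  · have h2 : (c : EReal) < φ (P u) := hb (y := P u) (by rwa [dist_eq_norm])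
    rw [← coe_F hnb hx, EReal.coe_lt_coe_iff] at h2
    have : 0 ≤ r / 2 * ‖P u - u‖ ^ 2 := by positivity
    linarith
  · have h2 := hlb _ hx
    have h3 := mul_le_mul_of_nonneg_left (norm_sq_le_two (P u) u) hK
    have h4 : δ ^ 2 ≤ ‖P u - u‖ ^ 2 := by nlinarith
    have h5 : |Q| / δ ^ 2 ≤ r / 2 - 2 * K := by
      have : 2 * |Q| / δ ^ 2 = 2 * (|Q| / δ ^ 2) := by ring
      linarith
    have h6 : 0 ≤ |Q| / δ ^ 2 := by positivity
    have h7 : |Q| / δ ^ 2 * δ ^ 2 ≤ (r / 2 - 2 * K) * ‖P u - u‖ ^ 2 :=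
      mul_le_mul h5 h4 (by positivity) (by linarith)
    rw [div_mul_cancel₀ _ (by positivity)] at h7
    have := le_abs_self Q
    linarith

end Existence

/-- a weakly convex function whose second subderivatives are
nonnegative at all points of twice epi-differentiability is convex. -/
theorem statement9 (n : ℕ) (φ : EuclideanSpace ℝ (Fin n) → EReal)
    (hnotbot : ∀ x, φ x ≠ ⊥) (hproper : ∃ x, φ x ≠ ⊤)
    (hlsc : LowerSemicontinuous φ)
    (ρ : ℝ) (hρ : 0 ≤ ρ) (hweak : ERealConvex (shiftFun ρ φ))
    (hyp : ∀ x v : EuclideanSpace ℝ (Fin n), (x, v) ∈ gphSubdiff ρ φ →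
      TwiceEpiDiff φ x v → ∀ w : EuclideanSpace ℝ (Fin n), 0 ≤ secondSubderiv φ x v w) :
    ERealConvex φ := by
  obtain ⟨A, K, hA, hK, hlb⟩ := lower_bound hnotbot hproper hlsc hρ hweak
  intro x y a b ha hb hab
  by_cases hx : φ x = ⊤
  · rcases eq_or_lt_of_le ha with h0 | h0
    · have : b = 1 := by linarith
      subst this; subst h0; simp
    · rw [hx, EReal.coe_mul_top_of_pos h0]
      have hne : (b : EReal) * φ y ≠ ⊥ := by
        by_cases hy : φ y = ⊤
        · rw [hy]
          rcases eq_or_lt_of_le hb with h1 | h1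
          · rw [← h1]; simp
          · rw [EReal.coe_mul_top_of_pos h1]; simp
        · rw [← coe_F hnotbot hy, ← EReal.coe_mul]; exact EReal.coe_ne_bot _
      rw [EReal.top_add_of_ne_bot hne]; exact le_top
  by_cases hy : φ y = ⊤
  · rcases eq_or_lt_of_le hb with h0 | h0
    · have : a = 1 := by linarith
      subst this; subst h0; simp
    · rw [hy, EReal.coe_mul_top_of_pos h0, ← coe_F hnotbot hx, ← EReal.coe_mul,
        EReal.coe_add_top]
      exact le_top
  by_contra hcon
  push Not at hcon
  obtain ⟨c, hc1, hc2⟩ := EReal.lt_iff_exists_real_btwn.1 hcon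
  rw [← coe_F hnotbot hx, ← coe_F hnotbot hy, ← EReal.coe_mul, ← EReal.coe_mul, ← EReal.coe_add,
    EReal.coe_lt_coe_iff] at hc1
  obtain ⟨R, hR⟩ := env_approx (ρ := ρ) hnotbot hlsc hK hlb (a • x + b • y) hc2
  set r := max R (max (ρ + 1) (4 * K + 1)) with hr
  have hr1 : R ≤ r := le_max_left _ _
  have hr2 : ρ + 1 ≤ r := (le_max_left _ _).trans (le_max_right _ _)
  have hr3 : 4 * K + 1 ≤ r := (le_max_right _ _).trans (le_max_right _ _)
  obtain ⟨P, hP⟩ := exists_PD hnotbot hproper hlsc hρ hweak (r := r) (by linarith) (by linarith) hlb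
  have h1 := hR r hr1 P hP
  have h2 := hP.env_convex (psd hnotbot hP hyp) x y ha hb hab
  have h3 := hP.env_le x hx
  have h4 := hP.env_le y hy
  simp only [sub_self, norm_zero] at h3 h4
  have h5 := mul_le_mul_of_nonneg_left h3 ha
  have h6 := mul_le_mul_of_nonneg_left h4 hb
  nlinarith

end
end
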